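/- arXiv:1302.0073 — 7 statements merged into one kernel-verified Lean document; each statement's English description precedes it below -/
import Mathlib

section
/- Let n ≥ 0 be an integer, and for each 0 ≤ j ≤ n let b_{j,n}(T) be the extremal polynomial. Then each b_{j,n}(T) has integer coefficients, and for every prime p ≥ 2n+5 and every integer k ≥ 1, the p-adic valuation of binom(kp−1, p−1) − Σ_{j=0}^{n} b_{j,n}(k)·p^j·H({1}^j; p−1) is at least 2n+3; that is, binom(kp−1, p−1) ≡ Σ_{j=0}^{n} b_{j,n}(k)·p^j·H({1}^j; p−1) (mod p^{2n+3}). -/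
open Finset Polynomial

/-- The multiple harmonic sum `H({1}^j; m)`: the `j`-th elementary symmetric
polynomial evaluated at `1, 1/2, ..., 1/m`. -/
noncomputable def mhs (j m : ℕ) : ℚ :=
  ∑ s ∈ Finset.powersetCard j (Finset.Icc 1 m), ∏ i ∈ s, (1 : ℚ) / i

/-- The polynomial `(X + 1) (X + 2) ⋯ (X + m)` with integer coefficients. -/
noncomputable def shiftedFactorialPoly (m : ℕ) : ℤ[X] :=
  ∏ i ∈ Icc 1 m, (X + C (i : ℤ))

theorem monic_shiftedFactorialPoly (m : ℕ) : (shiftedFactorialPoly m).Monic :=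
  monic_prod_of_monic _ _ fun _ _ => monic_X_add_C _

theorem natDegree_shiftedFactorialPoly (m : ℕ) : (shiftedFactorialPoly m).natDegree = m := by
  rw [shiftedFactorialPoly, natDegree_prod_of_monic _ _ fun _ _ => monic_X_add_C _]
  simp only [natDegree_X_add_C, sum_const, Nat.card_Icc, smul_eq_mul, mul_one, Nat.add_sub_cancel]

theorem map_shiftedFactorialPoly (m : ℕ) :
    (shiftedFactorialPoly m).map (Int.castRingHom ℚ) =
      C (m.factorial : ℚ) * ∑ j ∈ range (m + 1), C (mhs j m) * X ^ j := by
  have hfac : (m.factorial : ℚ) = ∏ i ∈ Icc 1 m, (i : ℚ) := by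
    rw [← Finset.prod_Ico_id_eq_factorial, Nat.cast_prod]
    rfl
  have hexp : ∏ i ∈ Icc 1 m, (C ((1 : ℚ) / i) * X + 1) =
      ∑ j ∈ range (m + 1), C (mhs j m) * X ^ j := by
    rw [Finset.prod_add_one, Finset.sum_powerset, Nat.card_Icc, Nat.add_sub_cancel]
    refine Finset.sum_congr rfl fun j _ => ?_
    rw [mhs, map_sum, Finset.sum_mul]
    refine Finset.sum_congr rfl fun s hs => ?_
    rw [Finset.prod_mul_distrib, Finset.prod_const, (Finset.mem_powersetCard.1 hs).2, map_prod]
  rw [← hexp, hfac, map_prod, ← Finset.prod_mul_distrib, shiftedFactorialPoly,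
    Polynomial.map_prod]
  refine Finset.prod_congr rfl fun i hi => ?_
  have hi0 : (i : ℚ) ≠ 0 := by
    have := (Finset.mem_Icc.1 hi).1
    positivity
  rw [mul_add, ← mul_assoc, ← C_mul, mul_one_div_cancel hi0]
  simp

theorem coeff_shiftedFactorialPoly (m j : ℕ) (hj : j ≤ m) :
    ((shiftedFactorialPoly m).coeff j : ℚ) = m.factorial * mhs j m := by
  have h := congrArg (fun f => coeff f j) (map_shiftedFactorialPoly m)
  simp only [coeff_map, coeff_C_mul, finsetSum_coeff, coeff_X_pow] at h
  simpa [Nat.lt_succ_of_le hj] using h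

theorem prime_dvd_coeff_shiftedFactorialPoly {p : ℕ} (hp : p.Prime) {j : ℕ} (hj : 0 < j)
    (hjp : j < p - 1) : (p : ℤ) ∣ (shiftedFactorialPoly (p - 1)).coeff j := by
  have := Fact.mk hp
  set P := (shiftedFactorialPoly (p - 1)).map (Int.castRingHom (ZMod p)) with hP
  have hdP : P.natDegree = p - 1 := by
    rw [hP, (monic_shiftedFactorialPoly _).natDegree_map, natDegree_shiftedFactorialPoly]
  have hmP : P.Monic := (monic_shiftedFactorialPoly _).map _
  have hp1 : p - 1 ≠ 0 := (Nat.sub_pos_of_lt hp.one_lt).ne'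
  have hmQ : (X ^ (p - 1) - C 1 : (ZMod p)[X]).Monic := monic_X_pow_sub_C _ hp1
  have hcast : ∀ i ∈ Icc 1 (p - 1), (i : ZMod p) ≠ 0 := by
    intro i hi h0
    rw [ZMod.natCast_eq_zero_iff] at h0
    have := Nat.le_of_dvd (by grind) h0
    grind
  have key : P = X ^ (p - 1) - C 1 := by
    refine eq_of_degree_le_of_eval_index_eq (v := fun i : ℕ => -(i : ZMod p))
      (Icc 1 (p - 1)) ?_ ?_ ?_ ?_ ?_
    · intro a ha b hb hab
      simp only [Finset.coe_Icc, Set.mem_Icc, neg_inj] at ha hb hab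
      have := (ZMod.natCast_eq_natCast_iff' a b p).1 hab
      rwa [Nat.mod_eq_of_lt (by omega), Nat.mod_eq_of_lt (by omega)] at this
    · rw [degree_eq_natDegree hmP.ne_zero, hdP]; simp
    · rw [degree_eq_natDegree hmP.ne_zero, degree_eq_natDegree hmQ.ne_zero, hdP,
        natDegree_X_pow_sub_C]
    · rw [hmP.leadingCoeff, hmQ.leadingCoeff]
    · intro i hi
      have h1 : eval (-(i : ZMod p)) P = 0 := by
        rw [hP, shiftedFactorialPoly, Polynomial.map_prod, eval_prod]
        exact Finset.prod_eq_zero hi (by simp)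
      rw [h1]
      simp [ZMod.pow_card_sub_one_eq_one (neg_ne_zero.2 (hcast i hi))]
  have h := congrArg (fun f => coeff f j) key
  simp only [hP, coeff_map, coeff_sub, coeff_X_pow, coeff_C, hjp.ne, hj.ne', if_false,
    sub_zero] at h
  exact (ZMod.intCast_zmod_eq_zero_iff_dvd _ p).1 h

theorem shiftedFactorialPoly_comp_symm {p : ℕ} (hp : Odd p) :
    (shiftedFactorialPoly (p - 1)).comp (C (p : ℤ) * (X - 1)) =
      (shiftedFactorialPoly (p - 1)).comp (C (p : ℤ) * -X) := by
  have hp0 : 0 < p := hp.pos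
  have heven : Even (p - 1) := Nat.Odd.sub_odd hp odd_one
  simp only [shiftedFactorialPoly, Polynomial.prod_comp, add_comp, X_comp, C_comp]
  calc ∏ i ∈ Icc 1 (p - 1), (C (p : ℤ) * (X - 1) + C (i : ℤ))
      = ∏ i ∈ Icc 1 (p - 1), (C (p : ℤ) * (X - 1) + C ((p - i : ℕ) : ℤ)) := by
        refine Finset.prod_bij' (fun i _ => p - i) (fun i _ => p - i) ?_ ?_ ?_ ?_ ?_ <;>
          intro i hi <;> simp only [Finset.mem_Icc] at hi ⊢
        · omega
        · omega
        · omega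
        · omega
        · rw [Nat.sub_sub_self (by omega)]
    _ = ∏ i ∈ Icc 1 (p - 1), (-1) * (C (p : ℤ) * -X + C (i : ℤ)) := by
        refine Finset.prod_congr rfl fun i hi => ?_
        rw [Nat.cast_sub (by simp only [Finset.mem_Icc] at hi; omega), C_sub]
        ring
    _ = _ := by
        rw [Finset.prod_mul_distrib, Finset.prod_const, Nat.card_Icc, Nat.add_sub_cancel,
          heven.neg_one_pow, one_mul]

theorem eval_shiftedFactorialPoly {p k : ℕ} (hp : 0 < p) (hk : 1 ≤ k) :
    ((shiftedFactorialPoly (p - 1)).comp (C (p : ℤ) * (X - 1))).eval (k : ℤ) =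
      (p - 1).factorial * (k * p - 1).choose (p - 1) := by
  obtain ⟨k, rfl⟩ := Nat.exists_eq_add_of_le' hk
  have h : (k + 1) * p - 1 = k * p + (p - 1) := by
    rw [add_mul, one_mul]; omega
  rw [h, ← Nat.cast_mul, ← Nat.ascFactorial_eq_factorial_mul_choose,
    Nat.ascFactorial_eq_prod_range, shiftedFactorialPoly, Polynomial.prod_comp, eval_prod,
    Finset.range_eq_Ico, Nat.cast_prod,
    ← Finset.Ico_add_one_right_eq_Icc, Finset.prod_Ico_eq_prod_range]
  simp only [Nat.add_sub_cancel, Finset.range_eq_Ico]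
  refine Finset.prod_congr rfl fun i _ => ?_
  simp
  ring

section

variable {R : Type*} [CommRing R]

theorem comp_C_mul_eq_sum (P Y : R[X]) (r : R) {N : ℕ} (hN : P.natDegree < N) :
    P.comp (C r * Y) = ∑ j ∈ range N, C (P.coeff j * r ^ j) * Y ^ j := by
  conv_lhs => rw [P.as_sum_range' N hN]
  simp [Polynomial.sum_comp, mul_pow, mul_assoc]

theorem pow_dvd_comp_sub_sum (P Y : R[X]) (r : R) (β : ℕ → R[X]) (n : ℕ)
    (h : ∀ j ≤ n, Y ^ (n + 1) ∣ β j - Y ^ j) :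
    Y ^ (n + 1) ∣ P.comp (C r * Y) - ∑ j ∈ range (n + 1), C (P.coeff j * r ^ j) * β j := by
  rw [comp_C_mul_eq_sum P Y r (N := (n + 1) + (P.natDegree + 1)) (by omega),
    Finset.sum_range_add, add_sub_right_comm, ← Finset.sum_sub_distrib]
  refine dvd_add (Finset.dvd_sum fun j hj => ?_) (Finset.dvd_sum fun j _ => ?_)
  · rw [← neg_sub, ← mul_sub, dvd_neg]
    exact Dvd.dvd.mul_left (h j (by grind)) _
  · exact Dvd.dvd.mul_left (pow_dvd_pow _ (by omega)) _

theorem C_pow_dvd_comp_sub (P Y M G : R[X]) (q : R) (d : ℕ) (hM : M.Monic)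
    (hMd : M.natDegree = d) (hY : Y.natDegree ≤ 1) (hG : G.degree < d) (hq : q ∣ P.coeff d)
    (hdvd : M ∣ P.comp (C q * Y) - G) : C (q ^ (d + 1)) ∣ P.comp (C q * Y) - G := by
  nontriviality R
  have hMdeg : M.degree = d := by rw [degree_eq_natDegree hM.ne_zero, hMd]
  have hG' : P.comp (C q * Y) %ₘ M = G := by
    rw [← (modByMonic_eq_self_iff (p := G) hM).2 (hMdeg ▸ hG), ← sub_eq_zero,
      ← sub_modByMonic, modByMonic_eq_zero_iff_dvd hM]
    exact hdvd
  set L := ∑ j ∈ range d, C (P.coeff j * q ^ j) * Y ^ j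
  have hLd : L.degree < M.degree := by
    rw [hMdeg]
    refine (mem_degreeLT (R := R)).1 (Submodule.sum_mem _ fun j hj => ?_)
    rw [mem_degreeLT]
    refine lt_of_le_of_lt ?_ (WithBot.coe_lt_coe.2 (Finset.mem_range.1 hj))
    refine degree_le_of_natDegree_le ?_
    refine (natDegree_C_mul_le _ _).trans (natDegree_pow_le.trans ?_)
    exact (Nat.mul_le_mul_left j hY).trans (by simp)
  obtain ⟨S, hS⟩ : C (q ^ (d + 1)) ∣ P.comp (C q * Y) - L := by
    rw [comp_C_mul_eq_sum P Y q (N := d + (P.natDegree + 1)) (by omega), Finset.sum_range_add,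
      add_sub_cancel_left]
    refine Finset.dvd_sum fun j _ => Dvd.dvd.mul_right (_root_.map_dvd C ?_) _
    rcases j with _ | j
    · rw [pow_succ', add_zero]
      exact mul_dvd_mul hq dvd_rfl
    · exact Dvd.dvd.mul_left (pow_dvd_pow _ (by omega)) _
  have hA : P.comp (C q * Y) = L + q ^ (d + 1) • S := by
    rw [smul_eq_C_mul, ← hS]; ring
  have hmod : G = L + q ^ (d + 1) • (S %ₘ M) := by
    rw [← hG', hA, add_modByMonic, smul_modByMonic, (modByMonic_eq_self_iff hM).2 hLd]
  rw [hA, hmod, add_sub_add_left_eq_sub, ← smul_sub, smul_eq_C_mul]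
  exact dvd_mul_right _ _

theorem isCoprime_X_X_sub_one : IsCoprime (X : R[X]) (X - 1) :=
  ⟨1, -1, by ring⟩

theorem monic_X_pow_mul_X_sub_one_pow (n : ℕ) : (X ^ n * (X - 1) ^ n : R[X]).Monic :=
  (monic_X_pow n).mul ((monic_X_sub_C (1 : R)).pow n)

theorem natDegree_X_pow_mul_X_sub_one_pow [Nontrivial R] (n : ℕ) :
    (X ^ n * (X - 1) ^ n : R[X]).natDegree = 2 * n := by
  have h : (X - 1 : R[X]) = X - C 1 := by simp
  rw [h, (monic_X_pow n).natDegree_mul ((monic_X_sub_C (1 : R)).pow n), natDegree_X_pow,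
    (monic_X_sub_C (1 : R)).natDegree_pow, natDegree_X_sub_C]
  ring

/-- The extremal polynomial exists over any commutative ring. -/
theorem exists_extremal [Nontrivial R] (n j : ℕ) : ∃ β : R[X], β.degree < (2 * (n + 1) : ℕ) ∧
    (X - 1) ^ (n + 1) ∣ β - (X - 1) ^ j ∧ X ^ (n + 1) ∣ β - (-X) ^ j := by
  obtain ⟨u, v, huv⟩ := (isCoprime_X_X_sub_one (R := R)).pow (m := n + 1) (n := n + 1)
  set M : R[X] := X ^ (n + 1) * (X - 1) ^ (n + 1) with hM
  have hMm : M.Monic := monic_X_pow_mul_X_sub_one_pow _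
  set f : R[X] := u * X ^ (n + 1) * (X - 1) ^ j + v * (X - 1) ^ (n + 1) * (-X) ^ j with hf
  obtain ⟨w, hw⟩ := dvd_modByMonic_sub f M
  rw [sub_eq_iff_eq_add] at hw
  refine ⟨f %ₘ M, ?_, ?_, ?_⟩
  · refine (degree_modByMonic_lt f hMm).trans_eq ?_
    rw [degree_eq_natDegree hMm.ne_zero, natDegree_X_pow_mul_X_sub_one_pow]
  · refine ⟨X ^ (n + 1) * w + v * ((-X) ^ j - (X - 1) ^ j), ?_⟩
    rw [hw, hM, hf]
    linear_combination (X - 1) ^ j * huv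
  · refine ⟨(X - 1) ^ (n + 1) * w + u * ((X - 1) ^ j - (-X) ^ j), ?_⟩
    rw [hw, hM, hf]
    linear_combination (-X) ^ j * huv

theorem eq_of_X_pow_dvd_of_X_sub_one_pow_dvd [Nontrivial R] {n : ℕ} {f g : R[X]}
    (hf : f.degree < (2 * n : ℕ)) (hg : g.degree < (2 * n : ℕ))
    (h0 : X ^ n ∣ f - g) (h1 : (X - 1) ^ n ∣ f - g) : f = g := by
  have hdvd : X ^ n * (X - 1) ^ n ∣ f - g := isCoprime_X_X_sub_one.pow.mul_dvd h0 h1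
  have hM := monic_X_pow_mul_X_sub_one_pow (R := R) n
  rw [← modByMonic_eq_zero_iff_dvd hM, sub_modByMonic] at hdvd
  have hMd : (X ^ n * (X - 1) ^ n : R[X]).degree = (2 * n : ℕ) := by
    rw [degree_eq_natDegree hM.ne_zero, natDegree_X_pow_mul_X_sub_one_pow]
  rwa [(modByMonic_eq_self_iff hM).2 (hMd ▸ hf), (modByMonic_eq_self_iff hM).2 (hMd ▸ hg),
    sub_eq_zero] at hdvd

end

/-- The integral form of the congruence, multiplied by `(p - 1)!`. -/
theorem prime_pow_dvd_factorial_mul_choose_sub {n : ℕ} {β : ℕ → ℤ[X]}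
    (hdeg : ∀ j ≤ n, (β j).degree < (2 * (n + 1) : ℕ))
    (h1 : ∀ j ≤ n, (X - 1) ^ (n + 1) ∣ β j - (X - 1) ^ j)
    (h0 : ∀ j ≤ n, X ^ (n + 1) ∣ β j - (-X) ^ j)
    {p : ℕ} (hp : p.Prime) (hnp : 2 * n + 5 ≤ p) {k : ℕ} (hk : 1 ≤ k) :
    (p : ℤ) ^ (2 * n + 3) ∣ (p - 1).factorial * (k * p - 1).choose (p - 1) -
      ∑ j ∈ range (n + 1), (shiftedFactorialPoly (p - 1)).coeff j * p ^ j * (β j).eval (k : ℤ) := by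
  set P := shiftedFactorialPoly (p - 1)
  have hsymm : P.comp (C (p : ℤ) * (X - 1)) = P.comp (C (p : ℤ) * -X) :=
    shiftedFactorialPoly_comp_symm (hp.odd_of_ne_two (by omega))
  have hneg : (-X : ℤ[X]) ^ (n + 1) = (-1) ^ (n + 1) * X ^ (n + 1) := neg_pow _ _
  have hunit : IsUnit ((-1 : ℤ[X]) ^ (n + 1)) := isUnit_one.neg.pow _
  have hd1 := pow_dvd_comp_sub_sum P (X - 1) (p : ℤ) β n h1
  have hd0 := pow_dvd_comp_sub_sum P (-X) (p : ℤ) β n fun j hj => by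
    rw [hneg, hunit.mul_left_dvd]
    exact h0 j hj
  rw [← hsymm, hneg, hunit.mul_left_dvd] at hd0
  have key := C_pow_dvd_comp_sub P (X - 1) _ _ (p : ℤ) (2 * (n + 1))
    (monic_X_pow_mul_X_sub_one_pow (n + 1)) (natDegree_X_pow_mul_X_sub_one_pow (n + 1))
    (by simpa using (natDegree_X_sub_C (1 : ℤ)).le)
    ((mem_degreeLT (R := ℤ)).1 (Submodule.sum_mem _ fun j hj => ?_))
    (prime_dvd_coeff_shiftedFactorialPoly hp (by omega) (by omega))
    (isCoprime_X_X_sub_one.pow.mul_dvd hd0 hd1)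
  · obtain ⟨S, hS⟩ := key
    have he := congrArg (eval (k : ℤ)) hS
    rw [eval_sub, eval_shiftedFactorialPoly hp.pos hk, eval_finsetSum] at he
    simp only [eval_mul, eval_C] at he
    exact ⟨_, he⟩
  · rw [← smul_eq_C_mul]
    exact Submodule.smul_mem _ _ (mem_degreeLT.2 (hdeg j (by grind)))

theorem stmt0 (n : ℕ) (b : ℕ → Polynomial ℚ)
    (hdeg : ∀ j ≤ n, (b j).natDegree ≤ 2 * n + 1)
    (hb1 : ∀ j ≤ n, (X - 1) ^ (n + 1) ∣ b j - (X - 1) ^ j)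
    (hb2 : ∀ j ≤ n, X ^ (n + 1) ∣ b j - (-1) ^ j * X ^ j) :
    (∀ j ≤ n, ∀ i, ((b j).coeff i).den = 1) ∧
    ∀ p : ℕ, p.Prime → 2 * n + 5 ≤ p → ∀ k : ℕ, 1 ≤ k →
      padicNorm p (((k * p - 1).choose (p - 1) : ℚ) -
          ∑ j ∈ Finset.range (n + 1), (b j).eval (k : ℚ) * (p : ℚ) ^ j * mhs j (p - 1))
        ≤ (p : ℚ) ^ (-(2 * (n : ℤ) + 3)) := by
  choose β hβdeg hβ1 hβ0 using exists_extremal (R := ℤ) n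
  have hb : ∀ j ≤ n, b j = (β j).map (Int.castRingHom ℚ) := by
    intro j hj
    refine eq_of_X_pow_dvd_of_X_sub_one_pow_dvd (n := n + 1) ?_
      (degree_map_le.trans_lt (hβdeg j)) ?_ ?_
    · refine (degree_le_of_natDegree_le (hdeg j hj)).trans_lt ?_
      exact_mod_cast (by omega : 2 * n + 1 < 2 * (n + 1))
    · have h := Polynomial.map_dvd (Int.castRingHom ℚ) (hβ0 j)
      simp only [Polynomial.map_sub, Polynomial.map_pow, Polynomial.map_neg, map_X] at h
      have h' := hb2 j hj
      rw [← neg_pow] at h'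
      simpa using dvd_sub h' h
    · have h := Polynomial.map_dvd (Int.castRingHom ℚ) (hβ1 j)
      simp only [Polynomial.map_sub, Polynomial.map_pow, Polynomial.map_one, map_X] at h
      simpa using dvd_sub (hb1 j hj) h
  refine ⟨fun j hj i => by rw [hb j hj, coeff_map]; simp, fun p hp hnp k hk => ?_⟩
  have := Fact.mk hp
  have hdvd := prime_pow_dvd_factorial_mul_choose_sub (fun j _ => hβdeg j) (fun j _ => hβ1 j)
    (fun j _ => hβ0 j) hp hnp hk
  rw [← Nat.cast_pow, padicNorm.dvd_iff_norm_le] at hdvd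
  have hfac : padicNorm p ((p - 1).factorial : ℚ) = 1 := by
    rw [padicNorm.nat_eq_one_iff, hp.dvd_factorial]
    have := hp.pos
    omega
  have heq : (((p - 1).factorial * (k * p - 1).choose (p - 1) -
      ∑ j ∈ range (n + 1), (shiftedFactorialPoly (p - 1)).coeff j * p ^ j * (β j).eval (k : ℤ) :
        ℤ) : ℚ) = (p - 1).factorial * (((k * p - 1).choose (p - 1) : ℚ) -
          ∑ j ∈ Finset.range (n + 1), (b j).eval (k : ℚ) * (p : ℚ) ^ j * mhs j (p - 1)) := by
    rw [mul_sub, Finset.mul_sum]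
    push_cast
    congr 1
    refine Finset.sum_congr rfl fun j hj => ?_
    have hjn : j ≤ n := Nat.lt_succ_iff.1 (Finset.mem_range.1 hj)
    rw [coeff_shiftedFactorialPoly _ _ (by omega), hb j hjn]
    have : eval (k : ℚ) ((β j).map (Int.castRingHom ℚ)) = (eval (k : ℤ) (β j) : ℤ) := by
      simp
    rw [this]
    ring
  rw [heq, padicNorm.mul, hfac, one_mul] at hdvd
  exact_mod_cast hdvd
end

section
/- Let n ≥ 0 be an integer such that p = 2n+3 is prime, and for each 0 ≤ j ≤ n let b_{j,n}(T) be the extremal polynomial. Then for every integer k ≥ 1, the p-adic valuation of binom(kp−1, p−1) − Σ_{j=0}^{n} b_{j,n}(k)·p^j·H({1}^j; p−1) is at least 2n+2; that is, binom(kp−1, p−1) ≡ Σ_{j=0}^{n} b_{j,n}(k)·p^j·H({1}^j; p−1) (mod p^{2n+2}). -/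
open Finset Polynomial

theorem prod_one_add_mul_C_one_div (m : ℕ) (y : ℚ[X]) :
    ∏ i ∈ Icc 1 m, (1 + y * C (1 / (i : ℚ))) = ∑ j ∈ range (m + 1), y ^ j * C (mhs j m) := by
  rw [Finset.prod_one_add, Finset.sum_powerset]
  simp only [Nat.card_Icc, Nat.add_sub_cancel]
  refine Finset.sum_congr rfl fun j _ => ?_
  rw [mhs, map_sum, Finset.mul_sum]
  refine Finset.sum_congr rfl fun s hs => ?_
  rw [Finset.prod_mul_distrib, Finset.prod_const, (Finset.mem_powersetCard.mp hs).2, map_prod]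

theorem mhs_self (m : ℕ) : mhs m m = 1 / (m.factorial : ℚ) := by
  have h : Finset.powersetCard m (Icc 1 m) = {Icc 1 m} := by
    simpa using Finset.powersetCard_self (Icc 1 m)
  rw [mhs, h, Finset.sum_singleton, Finset.prod_div_distrib, Finset.prod_const_one,
    ← prod_Ico_id_eq_factorial, Nat.cast_prod, Ico_add_one_right_eq_Icc]

theorem cast_add_choose_eq_prod (a m : ℕ) :
    ((a + m).choose m : ℚ) = ∏ i ∈ Icc 1 m, (1 + (a : ℚ) * (1 / (i : ℚ))) := by
  induction m with
  | zero => simp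
  | succ m ih =>
    rw [Finset.prod_Icc_succ_top (by omega), ← ih]
    have h : ((a + m + 1 : ℕ) : ℚ) * ((a + m).choose m : ℚ) =
        ((a + m + 1).choose (m + 1) : ℚ) * ((m + 1 : ℕ) : ℚ) := by
      exact_mod_cast Nat.add_one_mul_choose_eq (a + m) m
    have hm : ((m + 1 : ℕ) : ℚ) ≠ 0 := by positivity
    rw [← add_assoc, eq_div_of_mul_eq hm h.symm]
    field_simp
    push_cast
    ring

theorem prod_one_add_reflect (m : ℕ) (hm : Even m) :
    ∏ i ∈ Icc 1 m, (1 + C ((m + 1 : ℕ) : ℚ) * (X - 1) * C (1 / (i : ℚ))) =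
      ∏ i ∈ Icc 1 m, (1 + -(C ((m + 1 : ℕ) : ℚ) * X) * C (1 / (i : ℚ))) := by
  have key : ∀ f : ℕ → ℚ[X], ∏ i ∈ Icc 1 m, f (m + 1 - i) = ∏ i ∈ Icc 1 m, f i := fun f =>
    Finset.prod_nbij' (fun i => m + 1 - i) (fun i => m + 1 - i)
      (by simp only [mem_Icc]; omega) (by simp only [mem_Icc]; omega)
      (by simp only [mem_Icc]; omega) (by simp only [mem_Icc]; omega) (fun _ _ => rfl)
  have hne : ∏ i ∈ Icc 1 m, C (i : ℚ) ≠ 0 := by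
    refine Finset.prod_ne_zero_iff.mpr fun i hi => ?_
    have := (mem_Icc.mp hi).1
    simp only [ne_eq, C_eq_zero, Nat.cast_eq_zero]
    omega
  have hC : ∀ i ∈ Icc 1 m, (C (1 / (i : ℚ)) * C (i : ℚ) : ℚ[X]) = 1 := by
    intro i hi
    have := (mem_Icc.mp hi).1
    rw [← C_mul, one_div_mul_cancel (by positivity), C_1]
  refine mul_right_cancel₀ hne ?_
  rw [← Finset.prod_mul_distrib, ← Finset.prod_mul_distrib,
    ← key fun i => (1 + -(C ((m + 1 : ℕ) : ℚ) * X) * C (1 / (i : ℚ))) * C (i : ℚ)]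
  have hneg : ∀ f : ℕ → ℚ[X], ∏ i ∈ Icc 1 m, f i = ∏ i ∈ Icc 1 m, -f i := fun f => by
    simp [Finset.prod_neg, hm.neg_one_pow]
  rw [hneg fun i => (1 + -(C ((m + 1 : ℕ) : ℚ) * X) * C (1 / ((m + 1 - i : ℕ) : ℚ))) *
    C ((m + 1 - i : ℕ) : ℚ)]
  refine Finset.prod_congr rfl fun i hi => ?_
  have hi' := mem_Icc.mp hi
  have h1 := hC i hi
  have h2 := hC (m + 1 - i) (mem_Icc.mpr (by omega))
  have h3 : (C ((m + 1 - i : ℕ) : ℚ) : ℚ[X]) = C ((m + 1 : ℕ) : ℚ) - C (i : ℚ) := by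
    rw [Nat.cast_sub (by omega), C_sub]
  linear_combination (C ((m + 1 : ℕ) : ℚ) * (X - 1)) * h1 - (C ((m + 1 : ℕ) : ℚ) * X) * h2 + h3

theorem pow_dvd_sum_range_sub {R : Type*} [CommRing R] (x : R) (u : ℕ → R) {n m : ℕ} (h : n ≤ m) :
    x ^ n ∣ ∑ j ∈ range m, x ^ j * u j - ∑ j ∈ range n, x ^ j * u j := by
  rw [← Finset.sum_range_add_sum_Ico _ h, add_sub_cancel_left]
  exact Finset.dvd_sum fun j hj => Dvd.dvd.mul_right (pow_dvd_pow x (mem_Ico.mp hj).1) _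

theorem stmt1 (n : ℕ) (hp : Nat.Prime (2 * n + 3)) (b : ℕ → Polynomial ℚ)
    (hdeg : ∀ j ≤ n, (b j).natDegree ≤ 2 * n + 1)
    (hb1 : ∀ j ≤ n, (X - 1) ^ (n + 1) ∣ b j - (X - 1) ^ j)
    (hb2 : ∀ j ≤ n, X ^ (n + 1) ∣ b j - (-1) ^ j * X ^ j) :
    ∀ k : ℕ, 1 ≤ k →
      padicNorm (2 * n + 3) (((k * (2 * n + 3) - 1).choose (2 * n + 2) : ℚ) -
          ∑ j ∈ Finset.range (n + 1),
            (b j).eval (k : ℚ) * ((2 * n + 3 : ℕ) : ℚ) ^ j * mhs j (2 * n + 2))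
        ≤ ((2 * n + 3 : ℕ) : ℚ) ^ (-(2 * (n : ℤ) + 2)) := by
  intro k hk
  have : Fact (2 * n + 3).Prime := ⟨hp⟩
  set p : ℕ := 2 * n + 3 with hpdef
  set c : ℚ := (p : ℚ) ^ (2 * n + 2) * mhs (2 * n + 2) (2 * n + 2) with hc
  set F : ℚ[X] := ∏ i ∈ Icc 1 (2 * n + 2), (1 + C (p : ℚ) * (X - 1) * C (1 / (i : ℚ))) with hF
  set G : ℚ[X] := ∑ j ∈ range (n + 1), b j * C ((p : ℚ) ^ j * mhs j (2 * n + 2)) with hG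
  set M : ℚ[X] := X ^ (n + 1) * (X - 1) ^ (n + 1) with hM
  have hF1 : F = ∑ j ∈ range (2 * n + 2 + 1),
      (X - 1) ^ j * C ((p : ℚ) ^ j * mhs j (2 * n + 2)) := by
    rw [hF, prod_one_add_mul_C_one_div]
    refine Finset.sum_congr rfl fun j _ => ?_
    rw [mul_pow, C_mul, C_pow]
    ring
  have hF2 : F = ∑ j ∈ range (2 * n + 2 + 1),
      X ^ j * ((-1) ^ j * C ((p : ℚ) ^ j * mhs j (2 * n + 2))) := by
    rw [hF, hpdef, prod_one_add_reflect (2 * n + 2) ⟨n + 1, by ring⟩, prod_one_add_mul_C_one_div]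
    refine Finset.sum_congr rfl fun j _ => ?_
    rw [neg_pow, mul_pow, C_mul, C_pow]
    ring
  have hd1 : (X - 1) ^ (n + 1) ∣ F - G := by
    have h := pow_dvd_sum_range_sub (X - 1 : ℚ[X])
      (fun j => C ((p : ℚ) ^ j * mhs j (2 * n + 2))) (show n + 1 ≤ 2 * n + 2 + 1 by omega)
    rw [← hF1] at h
    have h' : (X - 1) ^ (n + 1) ∣ ∑ j ∈ range (n + 1),
        (b j - (X - 1) ^ j) * C ((p : ℚ) ^ j * mhs j (2 * n + 2)) :=
      Finset.dvd_sum fun j hj =>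
        (hb1 j (Nat.lt_succ_iff.mp (Finset.mem_range.mp hj))).mul_right _
    convert h.sub h' using 1
    simp only [hG, sub_mul, Finset.sum_sub_distrib]
    ring
  have hd2 : X ^ (n + 1) ∣ F - G := by
    have h := pow_dvd_sum_range_sub (X : ℚ[X])
      (fun j => (-1) ^ j * C ((p : ℚ) ^ j * mhs j (2 * n + 2)))
      (show n + 1 ≤ 2 * n + 2 + 1 by omega)
    rw [← hF2] at h
    have h' : X ^ (n + 1) ∣ ∑ j ∈ range (n + 1),
        (b j - (-1) ^ j * X ^ j) * C ((p : ℚ) ^ j * mhs j (2 * n + 2)) :=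
      Finset.dvd_sum fun j hj =>
        (hb2 j (Nat.lt_succ_iff.mp (Finset.mem_range.mp hj))).mul_right _
    convert h.sub h' using 1
    have : ∀ j, (X : ℚ[X]) ^ j * ((-1) ^ j * C ((p : ℚ) ^ j * mhs j (2 * n + 2))) =
        (-1) ^ j * X ^ j * C ((p : ℚ) ^ j * mhs j (2 * n + 2)) := fun j => by ring
    simp only [hG, sub_mul, Finset.sum_sub_distrib, this]
    ring
  have hMmonic : M.Monic := by
    have : (X - 1 : ℚ[X]).Monic := by simpa using monic_X_sub_C (1 : ℚ)
    exact (monic_X_pow _).mul (this.pow _)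
  have hMdeg : M.degree = (2 * n + 2 : ℕ) := by
    have : (X - 1 : ℚ[X]).degree = 1 := by simpa using degree_X_sub_C (1 : ℚ)
    rw [hM, degree_mul, degree_pow, degree_pow, this, degree_X]
    simp only [nsmul_eq_mul, mul_one]
    norm_cast
    omega
  have hMdvd : M ∣ F - G := by
    have hco : IsCoprime (X : ℚ[X]) (X - 1) := ⟨1, -1, by ring⟩
    exact hco.pow.mul_dvd hd2 hd1
  have hFG : F - G = C c * M := by
    have hGdeg : G ∈ degreeLT ℚ (2 * n + 2) := by
      refine Submodule.sum_mem _ fun j hj => ?_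
      rw [mul_comm (b j), ← smul_eq_C_mul]
      refine Submodule.smul_mem _ _ (mem_degreeLT.mpr ?_)
      refine (natDegree_le_iff_degree_le.mp
        (hdeg j (Nat.lt_succ_iff.mp (Finset.mem_range.mp hj)))).trans_lt ?_
      exact_mod_cast Nat.lt_succ_self (2 * n + 1)
    have hFdeg : F - C c * X ^ (2 * n + 2) ∈ degreeLT ℚ (2 * n + 2) := by
      rw [hF2, Finset.sum_range_succ, Even.neg_one_pow ⟨n + 1, by ring⟩, one_mul,
        mul_comm (X ^ (2 * n + 2)), add_sub_cancel_right]
      refine Submodule.sum_mem _ fun j hj => ?_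
      have : (X : ℚ[X]) ^ j * ((-1) ^ j * C ((p : ℚ) ^ j * mhs j (2 * n + 2))) =
          ((-1) ^ j * ((p : ℚ) ^ j * mhs j (2 * n + 2))) • X ^ j := by
        rw [smul_eq_C_mul, C_mul (a := (-1) ^ j), C_pow, C_neg, C_1]
        ring
      rw [this]
      refine Submodule.smul_mem _ _ (mem_degreeLT.mpr ?_)
      rw [degree_X_pow]
      exact_mod_cast Finset.mem_range.mp hj
    have hXdeg : C c * (X ^ (2 * n + 2) - M) ∈ degreeLT ℚ (2 * n + 2) := by
      rw [← smul_eq_C_mul]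
      refine Submodule.smul_mem _ _ (mem_degreeLT.mpr ?_)
      rw [← degree_X_pow (R := ℚ) (2 * n + 2)]
      exact degree_sub_lt_left (by rw [hMdeg, degree_X_pow]) (pow_ne_zero _ X_ne_zero)
        (by rw [hMmonic.leadingCoeff, leadingCoeff_X_pow])
    rw [← sub_eq_zero]
    refine eq_zero_of_dvd_of_degree_lt (dvd_sub hMdvd (dvd_mul_left M (C c))) ?_
    have : F - G - C c * M = F - C c * X ^ (2 * n + 2) + C c * (X ^ (2 * n + 2) - M) - G := by
      ring
    rw [hMdeg, this, ← mem_degreeLT]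
    exact Submodule.sub_mem _ (Submodule.add_mem _ hFdeg hXdeg) hGdeg
  have hFk : F.eval (k : ℚ) = ((k * p - 1).choose (2 * n + 2) : ℚ) := by
    obtain ⟨l, rfl⟩ : ∃ l, k = l + 1 := ⟨k - 1, by omega⟩
    have : (l + 1) * p - 1 = l * p + (2 * n + 2) := by
      rw [add_mul]
      omega
    rw [this, cast_add_choose_eq_prod, hF, eval_prod]
    refine Finset.prod_congr rfl fun i _ => ?_
    simp only [eval_add, eval_mul, eval_sub, eval_one, eval_C, eval_X]
    push_cast
    ring
  have hGk : G.eval (k : ℚ) = ∑ j ∈ range (n + 1),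
      (b j).eval (k : ℚ) * (p : ℚ) ^ j * mhs j (2 * n + 2) := by
    rw [hG, eval_finsetSum]
    refine Finset.sum_congr rfl fun j _ => ?_
    rw [eval_mul, eval_C, mul_assoc]
  rw [← hFk, ← hGk, ← eval_sub, hFG, eval_mul, eval_C]
  have hMk : M.eval (k : ℚ) = (((k : ℤ) ^ (n + 1) * ((k : ℤ) - 1) ^ (n + 1) : ℤ) : ℚ) := by
    simp [hM]
  have hfac : padicNorm p ((2 * n + 2).factorial : ℚ) = 1 := by
    rw [padicNorm.nat_eq_one_iff, hp.dvd_factorial]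
    omega
  rw [hMk, hc, mhs_self, padicNorm.mul, padicNorm.mul, padicNorm.div, hfac, padicNorm.one,
    div_one, mul_one, IsAbsoluteValue.abv_pow (padicNorm p), padicNorm.padicNorm_p hp.one_lt]
  refine (mul_le_of_le_one_right (by positivity) (padicNorm.of_int _)).trans_eq ?_
  rw [inv_pow, zpow_neg]
  norm_cast
end

section
/- Let n ≥ 0 be an integer such that p = 2n+3 is prime, let k be an integer, and for each 0 ≤ j ≤ n let b_{j,n}(T) be the extremal polynomial. Then the p-adic valuation of binom(kp−1, p−1) − Σ_{j=0}^{n} b_{j,n}(k)·p^j·H({1}^j; p−1) is at least 2n+3 if and only if k ≡ 0 (mod p) or k ≡ 1 (mod p). -/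
open Finset Polynomial

/-- The generating polynomial of the multiple harmonic sums `mhs j m`. -/
theorem prod_one_add_C_mul_eq_sum_mhs (m : ℕ) (Y : ℚ[X]) :
    ∏ i ∈ Icc 1 m, (1 + C ((1 : ℚ) / i) * Y) = ∑ j ∈ range (m + 1), C (mhs j m) * Y ^ j := by
  rw [Finset.prod_one_add, Finset.sum_powerset, Nat.card_Icc, Nat.add_sub_cancel]
  refine Finset.sum_congr rfl fun j _ => ?_
  rw [mhs, map_sum, Finset.sum_mul]
  refine Finset.sum_congr rfl fun t ht => ?_
  rw [Finset.prod_mul_distrib, Finset.prod_const, (Finset.mem_powersetCard.mp ht).2, map_prod]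

theorem C_factorial_mul_prod_one_add (m : ℕ) (Y : ℚ[X]) :
    C (m.factorial : ℚ) * ∏ i ∈ Icc 1 m, (1 + C ((1 : ℚ) / i) * Y) =
      ∏ i ∈ Icc 1 m, (C (i : ℚ) + Y) := by
  rw [← Finset.prod_Ico_id_eq_factorial, Finset.Ico_add_one_right_eq_Icc,
    Nat.cast_prod, map_prod, ← Finset.prod_mul_distrib]
  refine Finset.prod_congr rfl fun i hi => ?_
  have hi : (i : ℚ) ≠ 0 := by
    have := (Finset.mem_Icc.mp hi).1
    positivity
  rw [mul_add, mul_one, ← mul_assoc, ← C_mul, mul_one_div_cancel hi, C_1, one_mul]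

theorem prod_Icc_add_reflect {m : ℕ} (hm : Even m) :
    ∏ i ∈ Icc 1 m, (C (i : ℚ) + C ((m : ℚ) + 1) * (X - 1)) =
      ∏ i ∈ Icc 1 m, (C (i : ℚ) + -(C ((m : ℚ) + 1) * X)) := by
  have hneg : ∏ i ∈ Icc 1 m, (C (i : ℚ) + -(C ((m : ℚ) + 1) * X)) =
      ∏ i ∈ Icc 1 m, -(C (i : ℚ) + -(C ((m : ℚ) + 1) * X)) := by
    rw [Finset.prod_neg, Nat.card_Icc, Nat.add_sub_cancel, hm.neg_one_pow, one_mul]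
  rw [hneg]
  refine Finset.prod_bij' (fun i _ => m + 1 - i) (fun i _ => m + 1 - i) ?_ ?_ ?_ ?_ ?_ <;>
    intro i hi <;> rw [Finset.mem_Icc] at hi
  · rw [Finset.mem_Icc]; omega
  · rw [Finset.mem_Icc]; omega
  · omega
  · omega
  · rw [Nat.cast_sub (by omega)]
    simp only [Nat.cast_add, Nat.cast_one, map_sub, map_add, map_one]
    ring

/-- The two expansions of `∏ (1 - (m + 1) X / i)`, around `0` and around `1`, agree. -/
theorem sum_mhs_reflect {m : ℕ} (hm : Even m) :
    ∑ j ∈ range (m + 1), C (mhs j m) * (-(C ((m : ℚ) + 1) * X)) ^ j =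
      ∑ j ∈ range (m + 1), C (mhs j m) * (C ((m : ℚ) + 1) * (X - 1)) ^ j := by
  have h0 : C (m.factorial : ℚ) ≠ 0 := C_ne_zero.mpr (by positivity)
  refine mul_left_cancel₀ h0 ?_
  rw [← prod_one_add_C_mul_eq_sum_mhs, ← prod_one_add_C_mul_eq_sum_mhs,
    C_factorial_mul_prod_one_add, C_factorial_mul_prod_one_add, prod_Icc_add_reflect hm]

theorem choose_eq_sum_mhs {m : ℕ} (hm : Even m) (t : ℚ) :
    Ring.choose (t * (m + 1) - 1) m =
      (∑ j ∈ range (m + 1), C (mhs j m) * (-(C ((m : ℚ) + 1) * X)) ^ j).eval t := by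
  have h0 : (m.factorial : ℚ) ≠ 0 := by positivity
  refine mul_left_cancel₀ h0 ?_
  have h1 : (m.factorial : ℚ) *
      (∑ j ∈ range (m + 1), C (mhs j m) * (-(C ((m : ℚ) + 1) * X)) ^ j).eval t =
      ∏ i ∈ Icc 1 m, ((i : ℚ) - (m + 1) * t) := by
    rw [← prod_one_add_C_mul_eq_sum_mhs, ← eval_C (a := (m.factorial : ℚ)) (x := t), ← eval_mul,
      C_factorial_mul_prod_one_add, eval_prod]
    refine Finset.prod_congr rfl fun i _ => ?_
    simp only [eval_add, eval_neg, eval_mul, eval_C, eval_X]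
    ring
  have h2 : ∏ i ∈ Icc 1 m, ((i : ℚ) - (m + 1) * t) = ∏ i ∈ Icc 1 m, -((i : ℚ) - (m + 1) * t) := by
    rw [Finset.prod_neg, Nat.card_Icc, Nat.add_sub_cancel, hm.neg_one_pow, one_mul]
  rw [h1, h2, ← nsmul_eq_mul, ← Ring.descPochhammer_eq_factorial_smul_choose,
    ← Polynomial.aeval_eq_smeval, aeval_def, ← eval_map, descPochhammer_map,
    descPochhammer_eval_eq_prod_range]
  rw [← Finset.Ico_add_one_right_eq_Icc, Finset.prod_Ico_eq_prod_range]
  refine Finset.prod_congr (by simp) fun i _ => ?_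
  push_cast
  ring

theorem C_mul_neg_mul_pow_sub_eq (a q : ℚ) (f : ℚ[X]) (j : ℕ) :
    C a * (-(C q * X)) ^ j - C (q ^ j * a) * f = C (q ^ j * a) * -(f - (-1) ^ j * X ^ j) := by
  rw [neg_pow, mul_pow, C_mul, C_pow]
  ring

theorem C_mul_mul_pow_sub_eq (a q : ℚ) (f : ℚ[X]) (j : ℕ) :
    C a * (C q * (X - 1)) ^ j - C (q ^ j * a) * f = C (q ^ j * a) * -(f - (X - 1) ^ j) := by
  rw [mul_pow, C_mul, C_pow]
  ring

theorem dvd_sum_range_sub_sum_range {R : Type*} [CommRing R] {d : R} {N M : ℕ} (h : N ≤ M)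
    {f g : ℕ → R} (h1 : ∀ j < N, d ∣ f j - g j) (h2 : ∀ j, N ≤ j → d ∣ f j) :
    d ∣ ∑ j ∈ range M, f j - ∑ j ∈ range N, g j := by
  rw [← Finset.sum_range_add_sum_Ico f h, add_sub_right_comm, ← Finset.sum_sub_distrib]
  exact dvd_add (Finset.dvd_sum fun j hj => h1 j (Finset.mem_range.mp hj))
    (Finset.dvd_sum fun j hj => h2 j (Finset.mem_Ico.mp hj).1)

/-- The error of the extremal approximation is an explicit multiple of `(X (X - 1)) ^ (n + 1)`. -/
theorem sum_mhs_sub_extremal (n : ℕ) (b : ℕ → ℚ[X])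
    (hdeg : ∀ j ≤ n, (b j).natDegree ≤ 2 * n + 1)
    (hb1 : ∀ j ≤ n, (X - 1) ^ (n + 1) ∣ b j - (X - 1) ^ j)
    (hb2 : ∀ j ≤ n, X ^ (n + 1) ∣ b j - (-1) ^ j * X ^ j) (q : ℚ) (hq : q = 2 * n + 3) :
    ∑ j ∈ range (2 * n + 3), C (mhs j (2 * n + 2)) * (-(C q * X)) ^ j -
        ∑ j ∈ range (n + 1), C (q ^ j * mhs j (2 * n + 2)) * b j =
      C (q ^ (2 * n + 2) / ((2 * n + 2).factorial : ℚ)) * (X ^ (n + 1) * (X - 1) ^ (n + 1)) := by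
  set G := ∑ j ∈ range (n + 1), C (q ^ j * mhs j (2 * n + 2)) * b j with hG
  have hX : X ^ (n + 1) ∣
      ∑ j ∈ range (2 * n + 3), C (mhs j (2 * n + 2)) * (-(C q * X)) ^ j - G := by
    refine dvd_sum_range_sub_sum_range (by omega) (fun j hj => ?_) fun j hj => ?_
    · rw [C_mul_neg_mul_pow_sub_eq]
      exact ((hb2 j (by omega)).neg_right).mul_left _
    · rw [← neg_mul, mul_pow]
      exact ((pow_dvd_pow X hj).mul_left _).mul_left _
  have hX1 : (X - 1) ^ (n + 1) ∣
      ∑ j ∈ range (2 * n + 3), C (mhs j (2 * n + 2)) * (-(C q * X)) ^ j - G := by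
    have hr := sum_mhs_reflect (m := 2 * n + 2) ⟨n + 1, by ring⟩
    have hq' : ((2 * n + 2 : ℕ) : ℚ) + 1 = q := by rw [hq]; push_cast; ring
    rw [hq'] at hr
    rw [hr]
    refine dvd_sum_range_sub_sum_range (by omega) (fun j hj => ?_) fun j hj => ?_
    · rw [C_mul_mul_pow_sub_eq]
      exact ((hb1 j (by omega)).neg_right).mul_left _
    · rw [mul_pow]
      exact ((pow_dvd_pow _ hj).mul_left _).mul_left _
  have hcop : IsCoprime (X ^ (n + 1) : ℚ[X]) ((X - 1) ^ (n + 1)) :=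
    IsCoprime.pow ⟨1, -1, by ring⟩
  have hm1 : (X - 1 : ℚ[X]).Monic := by simpa using monic_X_sub_C (1 : ℚ)
  have hd1 : (X - 1 : ℚ[X]).natDegree = 1 := by simpa using natDegree_X_sub_C (1 : ℚ)
  have hmonic : (X ^ (n + 1) * (X - 1) ^ (n + 1) : ℚ[X]).Monic :=
    (monic_X_pow _).mul (hm1.pow _)
  have hdegM : (X ^ (n + 1) * (X - 1) ^ (n + 1) : ℚ[X]).natDegree = 2 * n + 2 := by
    rw [(monic_X_pow _).natDegree_mul (hm1.pow _), natDegree_X_pow, hm1.natDegree_pow, hd1]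
    ring
  obtain ⟨Q, hQ⟩ := hcop.mul_dvd hX hX1
  have hGdeg : G.natDegree ≤ 2 * n + 1 :=
    natDegree_sum_le_of_forall_le _ _ fun j hj =>
      (natDegree_C_mul_le _ _).trans (hdeg j (by rw [Finset.mem_range] at hj; omega))
  have hterm : ∀ j, C (mhs j (2 * n + 2)) * (-(C q * X)) ^ j =
      C (mhs j (2 * n + 2) * (-q) ^ j) * X ^ j := fun j => by
    rw [← neg_mul, mul_pow, C_mul, C_pow, C_neg, mul_assoc]
  simp only [hterm] at hQ ⊢
  set F := ∑ j ∈ range (2 * n + 3), C (mhs j (2 * n + 2) * (-q) ^ j) * X ^ j with hF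
  have hFdeg : F.natDegree ≤ 2 * n + 2 :=
    natDegree_sum_le_of_forall_le _ _ fun j hj =>
      (natDegree_C_mul_X_pow_le _ _).trans (by rw [Finset.mem_range] at hj; omega)
  have hFcoeff : F.coeff (2 * n + 2) = q ^ (2 * n + 2) / ((2 * n + 2).factorial : ℚ) := by
    rw [hF, finsetSum_coeff, Finset.sum_eq_single (2 * n + 2)]
    · rw [coeff_C_mul_X_pow, if_pos rfl, mhs_self, Even.neg_pow ⟨n + 1, by ring⟩]
      ring
    · intro j _ hj
      rw [coeff_C_mul_X_pow, if_neg hj.symm]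
    · intro h
      exact absurd (Finset.mem_range.mpr (by omega)) h
  have hQ0 : Q.natDegree = 0 := by
    by_cases h : Q = 0
    · rw [h, natDegree_zero]
    have h1 : (F - G).natDegree ≤ 2 * n + 2 :=
      (natDegree_sub_le _ _).trans (max_le hFdeg (by omega))
    rw [hQ, hmonic.natDegree_mul' h, hdegM] at h1
    omega
  rw [natDegree_eq_zero] at hQ0
  obtain ⟨c, rfl⟩ := hQ0
  have hc := congrArg (fun P => coeff P (2 * n + 2)) hQ
  simp only [coeff_sub, coeff_mul_C] at hc
  rw [hFcoeff, coeff_eq_zero_of_natDegree_lt (by omega), sub_zero, ← hdegM,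
    hmonic.coeff_natDegree, one_mul, hdegM] at hc
  rw [hQ, hc, mul_comm]

theorem stmt4 (n : ℕ) (hp : Nat.Prime (2 * n + 3)) (k : ℤ)
    (b : ℕ → Polynomial ℚ)
    (hdeg : ∀ j ≤ n, (b j).natDegree ≤ 2 * n + 1)
    (hb1 : ∀ j ≤ n, (X - 1) ^ (n + 1) ∣ b j - (X - 1) ^ j)
    (hb2 : ∀ j ≤ n, X ^ (n + 1) ∣ b j - (-1) ^ j * X ^ j) :
    padicNorm (2 * n + 3) (Ring.choose ((k : ℚ) * (2 * n + 3) - 1) (2 * n + 2) -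
        ∑ j ∈ Finset.range (n + 1),
          (b j).eval (k : ℚ) * ((2 * n + 3 : ℕ) : ℚ) ^ j * mhs j (2 * n + 2))
      ≤ ((2 * n + 3 : ℕ) : ℚ) ^ (-(2 * (n : ℤ) + 3)) ↔
    ((2 * n + 3 : ℤ) ∣ k ∨ (2 * n + 3 : ℤ) ∣ (k - 1)) := by
  have hfact : Fact (Nat.Prime (2 * n + 3)) := ⟨hp⟩
  have hkey := congrArg (eval (k : ℚ)) (sum_mhs_sub_extremal n b hdeg hb1 hb2 (2 * n + 3) rfl)
  have hch := choose_eq_sum_mhs (m := 2 * n + 2) ⟨n + 1, by ring⟩ (k : ℚ)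
  have hq : ((2 * n + 2 : ℕ) : ℚ) + 1 = 2 * n + 3 := by push_cast; ring
  rw [hq] at hch
  have hpc : ((2 * n + 3 : ℕ) : ℚ) = 2 * n + 3 := by push_cast; ring
  have hsum : ∑ j ∈ Finset.range (n + 1),
      (b j).eval (k : ℚ) * ((2 * n + 3 : ℕ) : ℚ) ^ j * mhs j (2 * n + 2) =
      (∑ j ∈ range (n + 1), C ((2 * n + 3 : ℚ) ^ j * mhs j (2 * n + 2)) * b j).eval (k : ℚ) := by
    rw [eval_finsetSum]
    refine Finset.sum_congr rfl fun j _ => ?_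
    rw [eval_mul, eval_C, hpc]
    ring
  rw [hch, hsum, ← eval_sub, hkey]
  have hval : eval (k : ℚ) (C ((2 * n + 3 : ℚ) ^ (2 * n + 2) / ((2 * n + 2).factorial : ℚ)) *
      (X ^ (n + 1) * (X - 1) ^ (n + 1))) =
      ((2 * n + 3 : ℕ) : ℚ) ^ (2 * n + 2) / ((2 * n + 2).factorial : ℚ) *
        ((k * (k - 1) : ℤ) : ℚ) ^ (n + 1) := by
    simp only [eval_mul, eval_C, eval_pow, eval_sub, eval_X, eval_one, hpc]
    push_cast
    rw [mul_pow]
  have hfac : padicNorm (2 * n + 3) ((2 * n + 2).factorial : ℚ) = 1 := by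
    rw [padicNorm.nat_eq_one_iff, hp.dvd_factorial]
    omega
  have hpos : (0 : ℚ) < ((2 * n + 3 : ℕ) : ℚ) := by positivity
  have hnorm : padicNorm (2 * n + 3) (((2 * n + 3 : ℕ) : ℚ) ^ (2 * n + 2) /
      ((2 * n + 2).factorial : ℚ) * ((k * (k - 1) : ℤ) : ℚ) ^ (n + 1)) =
      ((2 * n + 3 : ℕ) : ℚ) ^ (-(2 * (n : ℤ) + 2)) *
        padicNorm (2 * n + 3) ((k * (k - 1) : ℤ) : ℚ) ^ (n + 1) := by
    have hpow : ∀ (x : ℚ) (j : ℕ),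
        padicNorm (2 * n + 3) (x ^ j) = padicNorm (2 * n + 3) x ^ j := fun x j =>
      map_pow (⟨⟨padicNorm (2 * n + 3), padicNorm.one⟩, padicNorm.mul⟩ : ℚ →* ℚ) x j
    rw [padicNorm.mul, padicNorm.div, hfac, div_one, hpow, hpow,
      padicNorm.padicNorm_p_of_prime, inv_pow, zpow_neg]
    norm_cast
  rw [hval, hnorm, show -(2 * (n : ℤ) + 3) = -(2 * (n : ℤ) + 2) + (-1) by ring,
    zpow_add₀ hpos.ne', mul_le_mul_iff_right₀ (zpow_pos hpos _)]
  have hprime : Prime (2 * n + 3 : ℤ) := by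
    have := Nat.prime_iff_prime_int.mp hp
    push_cast at this
    exact this
  have hcast : ((2 * n + 3 : ℕ) : ℤ) = 2 * n + 3 := by push_cast; ring
  rw [← hprime.dvd_mul]
  constructor
  · intro h
    by_contra hnd
    rw [← hcast, ← padicNorm.int_eq_one_iff] at hnd
    rw [hnd, one_pow, zpow_neg_one] at h
    exact absurd h (not_le.mpr (inv_lt_one_of_one_lt₀ (by exact_mod_cast hp.one_lt)))
  · intro h
    have hle := (padicNorm.dvd_iff_norm_le (p := 2 * n + 3) (n := 1) (z := k * (k - 1))).mp
      (by rw [pow_one, hcast]; exact h)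
    rw [Nat.cast_one] at hle
    exact (pow_le_of_le_one (padicNorm.nonneg _) (padicNorm.of_int _) (by omega)).trans hle
end

section
/- Let n ≥ 0 be an integer, let k be an integer, and let c_0, c_1, ..., c_n be rational numbers. For 0 ≤ j ≤ n define b_j := (k−1)^j + c_j + (−1)^{n+j+1} Σ_{i=0}^{j} binom(j, i)·c_i. Then binom(k(n+1)−1, n) = Σ_{j=0}^{n} b_j · (n+1)^j · H({1}^j; n). -/
open Finset Polynomial

/-- Generating function of the multiple harmonic sums, in any commutative `ℚ`-algebra. -/
theorem prod_one_add_smul_eq_sum_mhs {A : Type*} [CommRing A] [Algebra ℚ A] (n : ℕ) (t : A) :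
    ∏ i ∈ Finset.Icc 1 n, (1 + ((1 : ℚ) / i) • t) =
      ∑ j ∈ Finset.range (n + 1), mhs j n • t ^ j := by
  rw [Finset.prod_one_add, Finset.sum_powerset, Nat.card_Icc, Nat.add_sub_cancel]
  refine Finset.sum_congr rfl fun j _ => ?_
  rw [mhs, Finset.sum_smul]
  refine Finset.sum_congr rfl fun s hs => ?_
  rw [Finset.prod_smul, Finset.prod_const, (Finset.mem_powersetCard.1 hs).2]

/-- The product `∏ (1 + t / i)` is, up to sign, invariant under `t ↦ -(n + 1) - t`. -/
theorem prod_one_add_smul_reflect {A : Type*} [CommRing A] [Algebra ℚ A] (n : ℕ) (t : A) :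
    ∏ i ∈ Finset.Icc 1 n, (1 + ((1 : ℚ) / i) • (-((n : A) + 1) - t)) =
      (-1) ^ n * ∏ i ∈ Finset.Icc 1 n, (1 + ((1 : ℚ) / i) • t) := by
  have factor (u : A) : ∏ i ∈ Finset.Icc 1 n, (1 + ((1 : ℚ) / i) • u) =
      (∏ i ∈ Finset.Icc 1 n, (1 : ℚ) / i) • ∏ i ∈ Finset.Icc 1 n, ((i : A) + u) := by
    rw [← Finset.prod_smul]
    refine Finset.prod_congr rfl fun i hi => ?_
    have hi0 : (i : ℚ) ≠ 0 := by
      have := (Finset.mem_Icc.1 hi).1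
      exact_mod_cast (by omega : i ≠ 0)
    have hi1 : (i : A) = (i : ℚ) • (1 : A) := by
      rw [Algebra.smul_def, map_natCast, mul_one]
    rw [smul_add, hi1, smul_smul, one_div, inv_mul_cancel₀ hi0, one_smul]
  have reflect : ∏ i ∈ Finset.Icc 1 n, ((i : A) + (-((n : A) + 1) - t)) =
      (-1) ^ n * ∏ i ∈ Finset.Icc 1 n, ((i : A) + t) := by
    have hsign : (-1 : A) ^ n = ∏ _i ∈ Finset.Icc 1 n, (-1 : A) := by simp
    rw [hsign, ← Finset.prod_mul_distrib]
    refine Finset.prod_nbij' (fun i => n + 1 - i) (fun i => n + 1 - i) ?_ ?_ ?_ ?_ ?_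
    · intro i hi; simp only [Finset.mem_Icc] at hi ⊢; omega
    · intro i hi; simp only [Finset.mem_Icc] at hi ⊢; omega
    · intro i hi; simp only [Finset.mem_Icc] at hi; omega
    · intro i hi; simp only [Finset.mem_Icc] at hi; omega
    · intro i hi
      have hle : i ≤ n + 1 := by have := (Finset.mem_Icc.1 hi).2; omega
      rw [Nat.cast_sub hle]
      push_cast
      ring
  rw [factor, factor, reflect, mul_smul_comm]

/-- The reflection symmetry, read off on coefficients. -/
theorem sum_choose_mul_mhs (n i : ℕ) (hi : i ≤ n) :
    ∑ j ∈ Finset.range (n + 1), (j.choose i : ℚ) * ((-((n : ℚ) + 1)) ^ j * mhs j n) =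
      (-1) ^ n * (((n : ℚ) + 1) ^ i * mhs i n) := by
  have h := prod_one_add_smul_reflect n (((n : ℚ[X]) + 1) * X)
  rw [prod_one_add_smul_eq_sum_mhs, prod_one_add_smul_eq_sum_mhs] at h
  have hC : ((n : ℚ[X]) + 1) = C ((n : ℚ) + 1) := by simp
  have hsign : (-1 : ℚ[X]) ^ n = C ((-1) ^ n) := by simp
  have hneg : -((n : ℚ[X]) + 1) - ((n : ℚ[X]) + 1) * X = C (-((n : ℚ) + 1)) * (1 + X) := by
    rw [hC, C_neg]; ring
  rw [hneg, hC, hsign] at h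
  have hc := congrArg (fun p => coeff p i) h
  simp only [mul_pow, ← C_pow, finsetSum_coeff, coeff_smul, coeff_C_mul, coeff_one_add_X_pow,
    coeff_X_pow, smul_eq_mul, mul_ite, mul_one, mul_zero, Finset.sum_ite_eq, Finset.mem_range,
    Nat.lt_succ_of_le hi, if_true] at hc
  rw [mul_comm _ (mhs i n), ← hc]
  exact Finset.sum_congr rfl fun j _ => by ring

/-- The binomial coefficient `binom(x + n, n)` as a generating function of harmonic sums. -/
theorem choose_add_natCast_eq_sum_mhs (n : ℕ) (x : ℚ) :
    Ring.choose (x + n) n = ∑ j ∈ Finset.range (n + 1), mhs j n * x ^ j := by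
  have h := prod_one_add_smul_eq_sum_mhs n x
  simp only [smul_eq_mul] at h
  rw [← h]
  have hasc : n.factorial • Ring.choose (x + n) n = ∏ i ∈ Finset.Icc 1 n, ((i : ℚ) + x) := by
    rw [Ring.choose, Ring.factorial_nsmul_multichoose_eq_ascPochhammer, add_sub_cancel_right,
      ascPochhammer_smeval_eq_eval]
    clear h
    induction n with
    | zero => simp
    | succ m ih =>
      rw [ascPochhammer_succ_eval, ih, Finset.prod_Icc_succ_top (by omega)]
      push_cast
      ring
  have hfac : ∏ i ∈ Finset.Icc 1 n, ((i : ℚ) + x) =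
      n.factorial * ∏ i ∈ Finset.Icc 1 n, (1 + (1 : ℚ) / i * x) := by
    rw [← Finset.prod_Ico_id_eq_factorial, Finset.Ico_add_one_right_eq_Icc, Nat.cast_prod,
      ← Finset.prod_mul_distrib]
    refine Finset.prod_congr rfl fun i hi => ?_
    have hi0 : (i : ℚ) ≠ 0 := by
      have := (Finset.mem_Icc.1 hi).1
      exact_mod_cast (by omega : i ≠ 0)
    field_simp
  rw [hfac, nsmul_eq_mul] at hasc
  exact mul_left_cancel₀ (by exact_mod_cast n.factorial_ne_zero) hasc

theorem stmt8 (n : ℕ) (k : ℤ) (c : ℕ → ℚ) (b : ℕ → ℚ)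
    (hb : ∀ j, b j = ((k : ℚ) - 1) ^ j + c j +
      (-1 : ℚ) ^ (n + j + 1) * ∑ i ∈ Finset.range (j + 1), (j.choose i : ℚ) * c i) :
    Ring.choose ((k : ℚ) * ((n : ℚ) + 1) - 1) n =
      ∑ j ∈ Finset.range (n + 1), b j * ((n : ℚ) + 1) ^ j * mhs j n := by
  have hx : (k : ℚ) * ((n : ℚ) + 1) - 1 = ((k : ℚ) - 1) * ((n : ℚ) + 1) + n := by ring
  have hext : ∀ j ∈ Finset.range (n + 1),
      ∑ i ∈ Finset.range (j + 1), (j.choose i : ℚ) * c i =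
        ∑ i ∈ Finset.range (n + 1), (j.choose i : ℚ) * c i := by
    intro j hj
    refine Finset.sum_subset (Finset.range_mono (by simpa using hj)) fun i _ hi => ?_
    rw [Nat.choose_eq_zero_of_lt (by simpa using hi), Nat.cast_zero, zero_mul]
  have hswap : ∑ j ∈ Finset.range (n + 1),
      ((-1 : ℚ) ^ (n + j + 1) * ∑ i ∈ Finset.range (j + 1), (j.choose i : ℚ) * c i) *
        ((n : ℚ) + 1) ^ j * mhs j n =
      -∑ i ∈ Finset.range (n + 1), c i * ((n : ℚ) + 1) ^ i * mhs i n := by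
    calc _ = ∑ j ∈ Finset.range (n + 1), ∑ i ∈ Finset.range (n + 1),
          (-1) ^ (n + 1) * c i * ((j.choose i : ℚ) * ((-((n : ℚ) + 1)) ^ j * mhs j n)) := by
          refine Finset.sum_congr rfl fun j hj => ?_
          rw [hext j hj, Finset.mul_sum, Finset.sum_mul, Finset.sum_mul]
          refine Finset.sum_congr rfl fun i _ => ?_
          rw [neg_pow ((n : ℚ) + 1)]
          ring
      _ = _ := by
          rw [Finset.sum_comm, ← Finset.sum_neg_distrib]
          refine Finset.sum_congr rfl fun i hi => ?_
          rw [← Finset.mul_sum, sum_choose_mul_mhs n i (by simpa [Nat.lt_succ_iff] using hi)]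
          have hsq : (-1 : ℚ) ^ n * (-1) ^ n = 1 := by rw [← mul_pow]; norm_num
          linear_combination (-(c i * ((n : ℚ) + 1) ^ i * mhs i n)) * hsq
  rw [hx, choose_add_natCast_eq_sum_mhs]
  simp only [hb, add_mul, Finset.sum_add_distrib]
  rw [hswap, add_neg_cancel_right]
  exact Finset.sum_congr rfl fun j _ => by rw [← mul_pow]; ring
end

section
/- For every odd prime p, the p-adic valuation of H({1}^{p−2}; p−1) − p/2 is at least 2; that is, H({1}^{p−2}; p−1) ≡ p/2 (mod p²). -/
open Finset Polynomial

theorem mhs_succ_succ (j m : ℕ) :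
    mhs (j + 1) (m + 1) = mhs (j + 1) m + mhs j m / ((m : ℚ) + 1) := by
  have hm : m + 1 ∉ Finset.Icc 1 m := by simp
  unfold mhs
  rw [← Finset.insert_Icc_right_eq_Icc_add_one (by omega), Finset.powersetCard_succ_insert hm,
    Finset.sum_union, Finset.sum_image, Finset.sum_div]
  · congr 1
    refine Finset.sum_congr rfl fun s hs => ?_
    have hs' : m + 1 ∉ s := fun h => hm ((Finset.mem_powersetCard.1 hs).1 h)
    rw [Finset.prod_insert hs']
    push_cast
    ring
  · intro s hs t ht hst
    have hs' : m + 1 ∉ s := fun h => hm ((Finset.mem_powersetCard.1 hs).1 h)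
    have ht' : m + 1 ∉ t := fun h => hm ((Finset.mem_powersetCard.1 ht).1 h)
    rw [← Finset.erase_insert hs', ← Finset.erase_insert ht']
    exact congrArg (fun u => Finset.erase u (m + 1)) hst
  · rw [Finset.disjoint_left]
    rintro s hs hs'
    obtain ⟨t, -, rfl⟩ := Finset.mem_image.1 hs'
    exact hm ((Finset.mem_powersetCard.1 hs).1 (Finset.mem_insert_self _ _))

theorem mhs_of_lt {j m : ℕ} (h : m < j) : mhs j m = 0 := by
  rw [mhs, Finset.powersetCard_eq_empty.2 (by simpa using h), Finset.sum_empty]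

theorem mhs_self_s9 (n : ℕ) : mhs n n = 1 / (n.factorial : ℚ) := by
  induction n with
  | zero => simp [mhs]
  | succ n ih =>
    rw [mhs_succ_succ, mhs_of_lt n.lt_succ_self, ih, Nat.factorial_succ]
    push_cast
    field_simp
    ring

theorem mhs_self_succ (n : ℕ) : mhs n (n + 1) = ((n : ℚ) + 2) / (2 * n.factorial) := by
  induction n with
  | zero => simp [mhs]
  | succ n ih =>
    have hn : (n.factorial : ℚ) ≠ 0 := by exact_mod_cast n.factorial_ne_zero
    rw [mhs_succ_succ, mhs_self_s9, ih, Nat.factorial_succ]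
    push_cast
    field_simp
    ring

theorem prime_dvd_one_sub_factorial_sub_two {p : ℕ} (hp : p.Prime) :
    (p : ℤ) ∣ 1 - ((p - 2).factorial : ℤ) := by
  have := Fact.mk hp
  obtain ⟨n, rfl⟩ := Nat.exists_eq_add_of_le' hp.two_le
  have hw := ZMod.wilsons_lemma (n + 2)
  have h0 : ((n : ZMod (n + 2)) + 2) = 0 := by exact_mod_cast ZMod.natCast_self (n + 2)
  rw [show n + 2 - 1 = n + 1 from rfl, Nat.factorial_succ] at hw
  rw [← ZMod.intCast_zmod_eq_zero_iff_dvd]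
  simp only [Nat.add_sub_cancel]
  push_cast at hw ⊢
  linear_combination hw - (n.factorial : ZMod (n + 2)) * h0

theorem stmt9 (p : ℕ) (hp : p.Prime) (hodd : Odd p) :
    padicNorm p (mhs (p - 2) (p - 1) - (p : ℚ) / 2) ≤ (p : ℚ) ^ (-(2 : ℤ)) := by
  have := Fact.mk hp
  have hp2 := hp.two_le
  have h2 : p ≠ 2 := by rintro rfl; exact absurd hodd (by decide)
  obtain ⟨k, hk⟩ := prime_dvd_one_sub_factorial_sub_two hp
  have hf : ((p - 2).factorial : ℚ) ≠ 0 := by exact_mod_cast (p - 2).factorial_ne_zero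
  have hndvd : ¬ p ∣ 2 * (p - 2).factorial := by
    rw [hp.dvd_mul, hp.dvd_factorial, Nat.prime_dvd_prime_iff_eq hp Nat.prime_two]
    omega
  have hnorm : padicNorm p ((2 * (p - 2).factorial : ℕ) : ℚ) = 1 :=
    (padicNorm.nat_eq_one_iff _).2 hndvd
  have hk' : 1 - ((p - 2).factorial : ℚ) = p * k := by exact_mod_cast hk
  have key : mhs (p - 2) (p - 1) - (p : ℚ) / 2 =
      (((p : ℤ) ^ 2 * k : ℤ) : ℚ) / ((2 * (p - 2).factorial : ℕ) : ℚ) := by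
    rw [show p - 1 = p - 2 + 1 by omega, mhs_self_succ]
    push_cast [Nat.cast_sub hp2]
    field_simp
    linear_combination (p : ℚ) * hk'
  rw [key, padicNorm.div, hnorm, div_one]
  have := (padicNorm.dvd_iff_norm_le (p := p) (n := 2) (z := (p : ℤ) ^ 2 * k)).1
    (by push_cast; exact dvd_mul_right _ _)
  exact_mod_cast this
end

section
/- Let k be an integer, let c_0, c_1, c_2, ... be rational numbers, and for each j ≥ 0 define b_j := (k−1)^j + c_j + (−1)^{j+1} Σ_{i=0}^{j} binom(j, i)·c_i. Let p be an odd prime such that every c_i has p-adic valuation ≥ 0, and let N be an even integer with 0 ≤ N ≤ p−4. Set E_N := binom(kp−1, p−1) − Σ_{j=0}^{N} b_j · p^j · H({1}^j; p−1). Then the p-adic valuation of E_N − ( (−B_{p−3−N}/(N+3)) · ( ((N+2)/2)·b_{N+1} + b_{N+2} ) · p^{N+3} ) is at least N+4. -/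
open Finset Polynomial

/-- `x` lies in `p ^ n ℤ_(p)`, i.e. its `p`-adic valuation is at least `n`. -/
def PadicPowDvd (p n : ℕ) (x : ℚ) : Prop :=
  padicNorm p x ≤ (p : ℚ) ^ (-(n : ℤ))

namespace PadicPowDvd

variable {p m n : ℕ} {x y : ℚ}

theorem neg (hx : PadicPowDvd p n x) : PadicPowDvd p n (-x) := by
  rwa [PadicPowDvd, padicNorm.neg]

theorem zero : PadicPowDvd p n 0 := by
  simp [PadicPowDvd]

theorem neg_one_pow_mul_iff : PadicPowDvd p n ((-1) ^ m * x) ↔ PadicPowDvd p n x := by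
  obtain h | h := neg_one_pow_eq_or ℚ m <;> simp [h, PadicPowDvd]

variable [hp : Fact p.Prime]

theorem add (hx : PadicPowDvd p n x) (hy : PadicPowDvd p n y) : PadicPowDvd p n (x + y) :=
  padicNorm.nonarchimedean.trans (max_le hx hy)

theorem sub (hx : PadicPowDvd p n x) (hy : PadicPowDvd p n y) : PadicPowDvd p n (x - y) :=
  padicNorm.sub.trans (max_le hx hy)

theorem mul (hx : PadicPowDvd p m x) (hy : PadicPowDvd p n y) :
    PadicPowDvd p (m + n) (x * y) := by
  have h0 : (p : ℚ) ≠ 0 := mod_cast hp.out.ne_zero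
  rw [PadicPowDvd, padicNorm.mul, Nat.cast_add, neg_add, zpow_add₀ h0]
  exact mul_le_mul hx hy (padicNorm.nonneg _) (by positivity)

theorem mono (h : m ≤ n) (hx : PadicPowDvd p n x) : PadicPowDvd p m x :=
  hx.trans (zpow_le_zpow_right₀ (mod_cast hp.out.one_le) (by omega))

theorem sum {ι : Type*} {s : Finset ι} {f : ι → ℚ} (h : ∀ i ∈ s, PadicPowDvd p n (f i)) :
    PadicPowDvd p n (∑ i ∈ s, f i) :=
  padicNorm.sum_le' h (by positivity)

theorem intCast (z : ℤ) : PadicPowDvd p 0 z := by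
  simpa [PadicPowDvd] using padicNorm.of_int (p := p) z

theorem natCast (z : ℕ) : PadicPowDvd p 0 z := mod_cast intCast (p := p) z

theorem intCast_iff {z : ℤ} : PadicPowDvd p n z ↔ (p : ℤ) ^ n ∣ z := by
  rw [PadicPowDvd, ← padicNorm.dvd_iff_norm_le, Nat.cast_pow]

theorem natCast_pow_self : PadicPowDvd p n ((p : ℚ) ^ n) := by
  have := (intCast_iff (p := p) (n := n)).2 (dvd_refl ((p : ℤ) ^ n))
  exact_mod_cast this

theorem natCast_self : PadicPowDvd p 1 (p : ℚ) := by
  simpa using natCast_pow_self (p := p) (n := 1)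

theorem mul_left (hy : PadicPowDvd p 0 y) (hx : PadicPowDvd p n x) : PadicPowDvd p n (y * x) := by
  simpa using hy.mul hx

theorem pow_mul (hx : PadicPowDvd p n x) : PadicPowDvd p (m + n) ((p : ℚ) ^ m * x) :=
  natCast_pow_self.mul hx

theorem of_nat_mul {a : ℕ} (ha : ¬ p ∣ a) (h : PadicPowDvd p n (a * x)) : PadicPowDvd p n x := by
  rwa [PadicPowDvd, padicNorm.mul, (padicNorm.nat_eq_one_iff a).2 ha, one_mul] at h

theorem of_padicValRat_nonneg (h : 0 ≤ padicValRat p x) : PadicPowDvd p 0 x := by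
  by_cases hx : x = 0
  · exact hx ▸ zero
  · rw [PadicPowDvd, padicNorm.eq_zpow_of_nonzero hx]
    exact zpow_le_zpow_right₀ (mod_cast hp.out.one_le) (by simpa using h)

end PadicPowDvd

/-- The `j`-th elementary symmetric polynomial evaluated at `1, 2, ..., m`. -/
def esymmIcc (j m : ℕ) : ℤ :=
  ∑ s ∈ powersetCard j (Icc 1 m), ∏ i ∈ s, (i : ℤ)

theorem factorial_mul_mhs {j m : ℕ} (h : j ≤ m) :
    (m.factorial : ℚ) * mhs j m = esymmIcc (m - j) m := by
  rw [mhs, esymmIcc, Finset.mul_sum]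
  push_cast
  have hs : ∀ k ≤ m, ∀ s ∈ powersetCard k (Icc 1 m),
      Icc 1 m \ s ∈ powersetCard (m - k) (Icc 1 m) := by
    intro k hk s hs
    rw [mem_powersetCard] at hs ⊢
    refine ⟨sdiff_subset, ?_⟩
    rw [card_sdiff_of_subset hs.1, hs.2]
    simp
  refine Finset.sum_bij' (fun s _ ↦ Icc 1 m \ s) (fun s _ ↦ Icc 1 m \ s) (hs j h)
    (fun s h' ↦ by simpa [Nat.sub_sub_self h] using hs (m - j) (Nat.sub_le _ _) s h') ?_ ?_ ?_
  · intro s hs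
    exact Finset.sdiff_sdiff_eq_self (mem_powersetCard.1 hs).1
  · intro s hs
    exact Finset.sdiff_sdiff_eq_self (mem_powersetCard.1 hs).1
  · intro s hs
    have hs := (mem_powersetCard.1 hs).1
    have hne : ∏ i ∈ s, (i : ℚ) ≠ 0 := Finset.prod_ne_zero_iff.2 fun i hi ↦ by
      have := (mem_Icc.1 (hs hi)).1
      positivity
    rw [← Finset.prod_Ico_id_eq_factorial, Finset.Ico_add_one_right_eq_Icc, Nat.cast_prod,
      ← Finset.prod_sdiff hs]
    simp only [one_div, Finset.prod_inv_distrib]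
    field_simp

theorem natCast_mul_esymmIcc (k m : ℕ) :
    (k : ℤ) * esymmIcc k m = (-1) ^ (k + 1) *
      ∑ a ∈ antidiagonal k with a.1 < k,
        (-1) ^ a.1 * esymmIcc a.1 m * ∑ i ∈ Icc 1 m, (i : ℤ) ^ a.2 := by
  have h := congrArg (MvPolynomial.aeval (fun i : Icc 1 m ↦ ((i : ℕ) : ℤ)))
    (MvPolynomial.mul_esymm_eq_sum (Icc 1 m) ℤ k)
  have he : ∀ j, MvPolynomial.aeval (fun i : Icc 1 m ↦ ((i : ℕ) : ℤ))
      (MvPolynomial.esymm (Icc 1 m) ℤ j) = esymmIcc j m := by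
    intro j
    rw [MvPolynomial.aeval_esymm_eq_multiset_esymm, esymmIcc,
      ← Finset.esymm_map_val]
    congr 1
    exact Multiset.attach_map_val' (Icc 1 m).val (fun i : ℕ ↦ (i : ℤ))
  have hq : ∀ j, MvPolynomial.aeval (fun i : Icc 1 m ↦ ((i : ℕ) : ℤ))
      (MvPolynomial.psum (Icc 1 m) ℤ j) = ∑ i ∈ Icc 1 m, (i : ℤ) ^ j := by
    intro j
    simp only [MvPolynomial.psum, map_sum, map_pow, MvPolynomial.aeval_X]
    exact Finset.sum_coe_sort (Icc 1 m) (fun i ↦ (i : ℤ) ^ j)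
  simpa only [map_mul, map_sum, map_pow, map_neg, map_one, map_natCast, he, hq] using h

theorem sum_pow_mul_mhs {A : Type*} [CommRing A] [Algebra ℚ A] (y : ℚ) (x : A) (n : ℕ) :
    ∑ j ∈ range (n + 1), algebraMap ℚ A (y ^ j * mhs j n) * x ^ j =
      ∏ i ∈ Icc 1 n, (1 + algebraMap ℚ A (y / i) * x) := by
  rw [Finset.prod_one_add, Finset.sum_powerset, Nat.card_Icc, Nat.add_sub_cancel]
  refine Finset.sum_congr rfl fun j _ ↦ ?_
  rw [mhs, Finset.mul_sum, map_sum, Finset.sum_mul]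
  refine Finset.sum_congr rfl fun s hs ↦ ?_
  rw [Finset.prod_mul_distrib, Finset.prod_const, (mem_powersetCard.1 hs).2, ← map_prod]
  congr 2
  simp only [div_eq_mul_inv, Finset.prod_mul_distrib, Finset.prod_const,
    (mem_powersetCard.1 hs).2, one_mul]

theorem prod_Icc_one_reflect {M : Type*} [CommMonoid M] (f : ℕ → M) (n : ℕ) :
    ∏ i ∈ Icc 1 n, f (n + 1 - i) = ∏ i ∈ Icc 1 n, f i := by
  refine Finset.prod_bij' (fun i _ ↦ n + 1 - i) (fun i _ ↦ n + 1 - i) ?_ ?_ ?_ ?_ ?_ <;>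
    intro i hi <;> (try simp only [mem_Icc] at *) <;> (try omega)

theorem factorial_mul_prod {A : Type*} [CommRing A] [Algebra ℚ A] (y : ℚ) (x : A) (n : ℕ) :
    (n.factorial : A) * ∏ i ∈ Icc 1 n, (1 + algebraMap ℚ A (y / i) * x) =
      ∏ i ∈ Icc 1 n, ((i : A) + algebraMap ℚ A y * x) := by
  rw [← Finset.prod_Ico_id_eq_factorial, Finset.Ico_add_one_right_eq_Icc, Nat.cast_prod,
    ← Finset.prod_mul_distrib]
  refine Finset.prod_congr rfl fun i hi ↦ ?_
  have h0 : (i : ℚ) ≠ 0 := by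
    have := (mem_Icc.1 hi).1
    positivity
  rw [mul_add, mul_one, ← mul_assoc, ← map_natCast (algebraMap ℚ A) i, ← map_mul,
    mul_div_cancel₀ _ h0]

theorem prod_one_add_reflect_s10 {A : Type*} [CommRing A] [Algebra ℚ A] (x : A) {n : ℕ}
    (hn : Even n) :
    ∏ i ∈ Icc 1 n, (1 + algebraMap ℚ A ((n + 1 : ℕ) / i) * (-1 - x)) =
      ∏ i ∈ Icc 1 n, (1 + algebraMap ℚ A ((n + 1 : ℕ) / i) * x) := by
  have hu : IsUnit (n.factorial : A) := by
    rw [← map_natCast (algebraMap ℚ A)]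
    exact (IsUnit.mk0 _ (mod_cast n.factorial_ne_zero)).map _
  refine hu.mul_left_cancel ?_
  rw [factorial_mul_prod, factorial_mul_prod, ← prod_Icc_one_reflect]
  have hneg : ∏ i ∈ Icc 1 n, -((i : A) + algebraMap ℚ A (n + 1 : ℕ) * x) =
      ∏ i ∈ Icc 1 n, ((i : A) + algebraMap ℚ A (n + 1 : ℕ) * x) := by
    rw [Finset.prod_neg, Nat.card_Icc, Nat.add_sub_cancel, hn.neg_one_pow, one_mul]
  rw [← hneg]
  refine Finset.prod_congr rfl fun i hi ↦ ?_
  rw [Nat.cast_sub (by have := (mem_Icc.1 hi).2; omega), map_natCast]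
  ring

theorem mhs_reflect {n : ℕ} (hn : Even n) (m : ℕ) (hm : m ≤ n) :
    ((n + 1 : ℕ) : ℚ) ^ m * mhs m n = ∑ j ∈ range (n + 1),
      ((n + 1 : ℕ) : ℚ) ^ j * mhs j n * ((-1) ^ j * (j.choose m : ℚ)) := by
  have h := prod_one_add_reflect_s10 (X : ℚ[X]) hn
  rw [← sum_pow_mul_mhs, ← sum_pow_mul_mhs] at h
  have h' := congrArg (fun f ↦ f.coeff m) h
  simp only [finsetSum_coeff, ← C_eq_algebraMap, coeff_C_mul] at h'
  have h2 : ∀ j, ((-1 - X : ℚ[X]) ^ j).coeff m = (-1) ^ j * (j.choose m : ℚ) := by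
    intro j
    rw [show (-1 - X : ℚ[X]) = C (-1) * (1 + X) by simp; ring, mul_pow, ← C_pow, coeff_C_mul,
      coeff_one_add_X_pow]
  simp only [h2] at h'
  rw [h']
  simp [coeff_X_pow, Finset.sum_ite_eq, Nat.lt_succ_of_le hm]

theorem sum_mul_eq_sum_binomial_transform {n : ℕ} (hn : Even n) (c : ℕ → ℚ) :
    ∑ j ∈ range (n + 1), c j * (((n + 1 : ℕ) : ℚ) ^ j * mhs j n) =
      ∑ j ∈ range (n + 1), (-1) ^ j * (∑ i ∈ range (j + 1), (j.choose i : ℚ) * c i) *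
        (((n + 1 : ℕ) : ℚ) ^ j * mhs j n) := by
  have hext : ∀ j ∈ range (n + 1), ∑ i ∈ range (j + 1), (j.choose i : ℚ) * c i =
      ∑ i ∈ range (n + 1), (j.choose i : ℚ) * c i := fun j hj ↦ by
    refine Finset.sum_subset (range_subset_range.2 (mem_range.1 hj)) fun i _ hi ↦ ?_
    rw [Nat.choose_eq_zero_of_lt (by simpa using hi), Nat.cast_zero, zero_mul]
  rw [Finset.sum_congr rfl fun i hi ↦ by
      rw [mhs_reflect hn i (Nat.lt_succ_iff.1 (mem_range.1 hi)), Finset.mul_sum],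
    Finset.sum_comm]
  refine Finset.sum_congr rfl fun j hj ↦ ?_
  rw [hext j hj, Finset.mul_sum, Finset.sum_mul]
  refine Finset.sum_congr rfl fun i _ ↦ ?_
  ring

theorem ringChoose_eq_sum {n : ℕ} (x : ℚ) :
    Ring.choose (x * (n + 1 : ℕ) - 1) n =
      ∑ j ∈ range (n + 1), ((n + 1 : ℕ) : ℚ) ^ j * mhs j n * (x - 1) ^ j := by
  have h := sum_pow_mul_mhs (A := ℚ) ((n + 1 : ℕ) : ℚ) (x - 1) n
  have h2 := factorial_mul_prod (A := ℚ) ((n + 1 : ℕ) : ℚ) (x - 1) n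
  simp only [Algebra.algebraMap_self, RingHom.id_apply] at h h2
  have hf : (n.factorial : ℚ) ≠ 0 := mod_cast n.factorial_ne_zero
  rw [h, Ring.choose_eq_smul, smul_eq_mul, inv_mul_eq_iff_eq_mul₀ hf, h2,
    ← aeval_eq_smeval, ← prod_Icc_one_reflect]
  have h3 : aeval (x * (n + 1 : ℕ) - 1) (descPochhammer ℤ n) =
      (descPochhammer ℚ n).eval (x * (n + 1 : ℕ) - 1) := by
    rw [← descPochhammer_map (algebraMap ℤ ℚ), eval_map_algebraMap]
  rw [h3, descPochhammer_eval_eq_prod_range, ← Finset.Ico_add_one_right_eq_Icc,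
    Finset.prod_Ico_eq_prod_range, Nat.add_sub_cancel]
  refine Finset.prod_congr rfl fun i hi ↦ ?_
  rw [Nat.cast_sub (by have := mem_range.1 hi; omega)]
  push_cast
  ring

section

variable {p : ℕ} [hp : Fact p.Prime]

theorem padicPowDvd_bernoulli {t : ℕ} (ht : t + 2 ≤ p) :
    PadicPowDvd p 0 (_root_.bernoulli t) := by
  induction t using Nat.strong_induction_on with
  | _ t ih =>
    refine PadicPowDvd.of_nat_mul (a := t + 1)
      (fun h ↦ by have := Nat.le_of_dvd (by omega) h; omega) ?_
    have h := _root_.sum_bernoulli (t + 1)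
    rw [Finset.sum_range_succ, Nat.choose_succ_self_right] at h
    rw [eq_sub_of_add_eq' h]
    refine PadicPowDvd.sub ?_ (PadicPowDvd.sum fun i hi ↦ ?_)
    · split_ifs
      · exact mod_cast PadicPowDvd.natCast (p := p) 1
      · exact PadicPowDvd.zero
    · have hi := mem_range.1 hi
      exact (PadicPowDvd.natCast _).mul_left (ih i hi (by omega))

theorem padicPowDvd_sum_pow_sub {K : ℕ} (hK : 1 ≤ K) (hKp : K + 2 ≤ p) :
    PadicPowDvd p 2 ((∑ i ∈ Icc 1 (p - 1), (i : ℤ) ^ K : ℤ) - p * _root_.bernoulli K) := by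
  have hsum : ((∑ i ∈ Icc 1 (p - 1), (i : ℤ) ^ K : ℤ) : ℚ) = ∑ i ∈ range p, (i : ℚ) ^ K := by
    rw [Finset.range_eq_Ico, Finset.sum_eq_sum_Ico_succ_bot hp.out.pos,
      ← Finset.Ico_add_one_right_eq_Icc, Nat.sub_add_cancel hp.out.one_le]
    simp [Nat.ne_of_gt hK]
  have hK0 : (K : ℚ) + 1 ≠ 0 := by positivity
  refine PadicPowDvd.of_nat_mul (a := K + 1)
    (fun h ↦ by have := Nat.le_of_dvd (by omega) h; omega) ?_
  rw [hsum, sum_range_pow, Finset.sum_range_succ, ← Finset.sum_div,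
    Nat.choose_succ_self_right, Nat.add_sub_cancel_left]
  have : ((K + 1 : ℕ) : ℚ) * ((∑ i ∈ range K, _root_.bernoulli i * ((K + 1).choose i) *
      (p : ℚ) ^ (K + 1 - i)) / (K + 1) + _root_.bernoulli K * (K + 1 : ℕ) * (p : ℚ) ^ 1 / (K + 1) -
      p * _root_.bernoulli K) = ∑ i ∈ range K, _root_.bernoulli i * ((K + 1).choose i) *
      (p : ℚ) ^ (K + 1 - i) := by
    push_cast
    field_simp
    ring
  rw [this]
  refine PadicPowDvd.sum fun i hi ↦ ?_
  have hi := mem_range.1 hi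
  exact ((padicPowDvd_bernoulli (by omega)).mul_left (PadicPowDvd.natCast _)).mul_left
    (PadicPowDvd.natCast_pow_self.mono (by omega))

theorem prime_dvd_sum_pow {K : ℕ} (hK : 1 ≤ K) (hKp : K + 2 ≤ p) :
    (p : ℤ) ∣ ∑ i ∈ Icc 1 (p - 1), (i : ℤ) ^ K := by
  rw [← pow_one (p : ℤ), ← PadicPowDvd.intCast_iff]
  have h := (padicPowDvd_sum_pow_sub hK hKp).mono one_le_two
  have h' := (PadicPowDvd.natCast_self (p := p)).mul (padicPowDvd_bernoulli hKp)
  simpa using h.add h'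

theorem prime_dvd_esymmIcc {j : ℕ} (hj : 1 ≤ j) (hjp : j + 2 ≤ p) :
    (p : ℤ) ∣ esymmIcc j (p - 1) := by
  have hpj : ¬ (p : ℤ) ∣ j := fun h ↦ by
    have := Nat.le_of_dvd hj (Int.natCast_dvd_natCast.1 h)
    omega
  refine ((Nat.prime_iff_prime_int.1 hp.out).dvd_or_dvd ?_).resolve_left hpj
  rw [natCast_mul_esymmIcc]
  refine Dvd.dvd.mul_left (Finset.dvd_sum fun a ha ↦ Dvd.dvd.mul_left ?_ _) _
  simp only [mem_filter, HasAntidiagonal.mem_antidiagonal] at ha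
  exact prime_dvd_sum_pow (by omega) (by omega)

theorem esymmIcc_zero (m : ℕ) : esymmIcc 0 m = 1 := by
  simp [esymmIcc]

theorem sq_dvd_mul_esymmIcc_add {K : ℕ} (hK : 1 ≤ K) (hKe : Even K) (hKp : K + 2 ≤ p) :
    (p : ℤ) ^ 2 ∣ K * esymmIcc K (p - 1) + ∑ i ∈ Icc 1 (p - 1), (i : ℤ) ^ K := by
  have hmem : (0, K) ∈ (antidiagonal K).filter (fun a ↦ a.1 < K) := by
    simp only [mem_filter, HasAntidiagonal.mem_antidiagonal]
    omega
  rw [natCast_mul_esymmIcc, ← Finset.add_sum_erase _ _ hmem, pow_succ (-1 : ℤ) K, hKe.neg_one_pow,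
    esymmIcc_zero]
  simp only [pow_zero, one_mul, neg_mul, neg_add_rev, neg_add_cancel_right]
  refine (Finset.dvd_sum fun a ha ↦ ?_).neg_right
  simp only [mem_erase, mem_filter, HasAntidiagonal.mem_antidiagonal] at ha
  have ha0 : a.1 ≠ 0 := fun h ↦ ha.1 (Prod.ext h (by simp; omega))
  rw [pow_two]
  exact mul_dvd_mul ((prime_dvd_esymmIcc (by omega) (by omega)).mul_left _)
    (prime_dvd_sum_pow (by omega) (by omega))

theorem not_prime_dvd_factorial_pred : ¬ p ∣ (p - 1).factorial := by
  rw [hp.out.dvd_factorial]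
  have := hp.out.pos
  omega

theorem padicPowDvd_zero_mhs {j : ℕ} (hj : j ≤ p - 1) : PadicPowDvd p 0 (mhs j (p - 1)) := by
  refine PadicPowDvd.of_nat_mul not_prime_dvd_factorial_pred ?_
  rw [factorial_mul_mhs hj]
  exact PadicPowDvd.intCast _

theorem padicPowDvd_one_mhs {j : ℕ} (hj : 1 ≤ j) (hjp : j + 2 ≤ p) :
    PadicPowDvd p 1 (mhs j (p - 1)) := by
  refine PadicPowDvd.of_nat_mul not_prime_dvd_factorial_pred ?_
  rw [factorial_mul_mhs (by omega), PadicPowDvd.intCast_iff, pow_one]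
  exact prime_dvd_esymmIcc (by omega) (by omega)

/-- Glaisher's congruence for `H({1}^m; p - 1)` modulo `p ^ 2`, with `K = p - 1 - m`. -/
theorem padicPowDvd_mhs_sub {m K : ℕ} (hm : 1 ≤ m) (hK : 1 ≤ K) (hKe : Even K)
    (hmK : m + K + 1 = p) :
    PadicPowDvd p 2 (mhs m (p - 1) - p * (-_root_.bernoulli K / (m + 1))) := by
  have hlt : ∀ a, 1 ≤ a → a < p → ¬ p ∣ a := fun a h1 h2 h ↦ by
    have := Nat.le_of_dvd h1 h
    omega
  refine PadicPowDvd.of_nat_mul not_prime_dvd_factorial_pred ?_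
  refine PadicPowDvd.of_nat_mul (hlt K hK (by omega)) ?_
  refine PadicPowDvd.of_nat_mul (hlt (m + 1) (by omega) (by omega)) ?_
  have hE := factorial_mul_mhs (j := m) (m := p - 1) (by omega)
  rw [show p - 1 - m = K by omega] at hE
  have hKS := PadicPowDvd.intCast_iff.2 (sq_dvd_mul_esymmIcc_add hK hKe (p := p) (by omega))
  have hS := padicPowDvd_sum_pow_sub hK (p := p) (by omega)
  have hB := padicPowDvd_bernoulli (p := p) (t := K) (by omega)
  have hW : PadicPowDvd p 1 (((p - 1).factorial + 1 : ℤ) : ℚ) := by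
    rw [PadicPowDvd.intCast_iff, pow_one, ← ZMod.intCast_zmod_eq_zero_iff_dvd]
    push_cast
    rw [ZMod.wilsons_lemma, neg_add_cancel]
  have hpQ : (p : ℚ) = m + K + 1 := by exact_mod_cast hmK.symm
  have hF : PadicPowDvd p 1 (((p - 1).factorial : ℚ) * K - (m + 1)) := by
    have h := ((PadicPowDvd.natCast K).mul_left hW).sub PadicPowDvd.natCast_self
    convert h using 1
    rw [hpQ]
    push_cast
    ring
  have hkey := ((PadicPowDvd.natCast (m + 1)).mul_left (hKS.sub hS)).add
    (PadicPowDvd.natCast_self.mul (hB.mul_left hF))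
  convert hkey using 1
  push_cast at hE ⊢
  have hm0 : (m : ℚ) + 1 ≠ 0 := by positivity
  rw [← hE]
  field_simp
  ring

theorem padicPowDvd_pow_mul_mhs {m j : ℕ} (hm : m + 4 ≤ p) (hj : j ∈ Ico (m + 2) p) :
    PadicPowDvd p (m + 3) ((p : ℚ) ^ j * mhs j (p - 1)) := by
  rw [mem_Ico] at hj
  obtain rfl | h := hj.1.eq_or_lt
  · exact PadicPowDvd.pow_mul (padicPowDvd_one_mhs (by omega) (by omega))
  · exact (PadicPowDvd.pow_mul (padicPowDvd_zero_mhs (by omega))).mono (by omega)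

/-- The parity reduction expressing `H({1}^m; p - 1)` for odd `m` through `H({1}^(m+1); p - 1)`. -/
theorem padicPowDvd_pow_mul_mhs_sub {m : ℕ} (hp2 : p ≠ 2) (hm : Odd m) (hmp : m + 4 ≤ p) :
    PadicPowDvd p (m + 3) ((p : ℚ) ^ m * mhs m (p - 1) -
      ((m : ℚ) + 1) / 2 * ((p : ℚ) ^ (m + 1) * mhs (m + 1) (p - 1))) := by
  have hpe : p - 1 + 1 = p := Nat.sub_add_cancel hp.out.one_le
  refine PadicPowDvd.of_nat_mul (a := 2)
    (fun h ↦ hp2 ((Nat.prime_dvd_prime_iff_eq hp.out Nat.prime_two).1 h)) ?_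
  have h := mhs_reflect (hp.out.even_sub_one hp2) m (by omega)
  rw [hpe, ← Finset.sum_range_add_sum_Ico _ (show m + 2 ≤ p by omega), Finset.sum_range_succ,
    Finset.sum_range_succ, Finset.sum_eq_zero (fun j hj ↦ by
      rw [Nat.choose_eq_zero_of_lt (mem_range.1 hj)]; simp), hm.neg_one_pow,
    hm.add_one.neg_one_pow, Nat.choose_self, Nat.choose_succ_self_right] at h
  have hrest : PadicPowDvd p (m + 3) (∑ j ∈ Ico (m + 2) p,
      (p : ℚ) ^ j * mhs j (p - 1) * ((-1) ^ j * (j.choose m : ℚ))) := by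
    refine PadicPowDvd.sum fun j hj ↦ ?_
    rw [mul_comm, mul_assoc, PadicPowDvd.neg_one_pow_mul_iff]
    exact (PadicPowDvd.natCast _).mul_left (padicPowDvd_pow_mul_mhs (by omega) hj)
  convert hrest using 1
  push_cast at h ⊢
  linear_combination h

end

theorem stmt10 (k : ℤ) (c : ℕ → ℚ) (b : ℕ → ℚ)
    (hb : ∀ j, b j = ((k : ℚ) - 1) ^ j + c j +
      (-1 : ℚ) ^ (j + 1) * ∑ i ∈ Finset.range (j + 1), (j.choose i : ℚ) * c i)
    (p : ℕ) (hp : p.Prime) (hodd : Odd p)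
    (hc : ∀ i, 0 ≤ padicValRat p (c i))
    (N : ℕ) (hN : Even N) (hNp : N + 4 ≤ p) :
    padicNorm p ((Ring.choose ((k : ℚ) * p - 1) (p - 1) -
          ∑ j ∈ Finset.range (N + 1), b j * (p : ℚ) ^ j * mhs j (p - 1)) -
        -(_root_.bernoulli (p - 3 - N)) / ((N : ℚ) + 3) *
          (((N : ℚ) + 2) / 2 * b (N + 1) + b (N + 2)) * (p : ℚ) ^ (N + 3))
      ≤ (p : ℚ) ^ (-((N : ℤ) + 4)) := by
  have : Fact p.Prime := ⟨hp⟩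
  have hp2 : p ≠ 2 := by rintro rfl; exact absurd hodd (by decide)
  have hN5 : N + 5 ≤ p := by
    obtain ⟨e, rfl⟩ := hodd
    obtain ⟨d, rfl⟩ := hN
    omega
  have hpe : p - 1 + 1 = p := Nat.sub_add_cancel hp.one_le
  set a : ℕ → ℚ := fun j ↦ (p : ℚ) ^ j * mhs j (p - 1) with ha
  have hci : ∀ i, PadicPowDvd p 0 (c i) := fun i ↦ PadicPowDvd.of_padicValRat_nonneg (hc i)
  have hbi : ∀ j, PadicPowDvd p 0 (b j) := fun j ↦ by
    rw [hb]
    refine (PadicPowDvd.add ?_ (hci j)).add (PadicPowDvd.neg_one_pow_mul_iff.2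
      (PadicPowDvd.sum fun i _ ↦ (PadicPowDvd.natCast _).mul_left (hci i)))
    exact mod_cast PadicPowDvd.intCast (p := p) ((k - 1) ^ j)
  have hchoose : Ring.choose ((k : ℚ) * p - 1) (p - 1) = ∑ j ∈ range p, b j * a j := by
    have h := ringChoose_eq_sum (n := p - 1) (k : ℚ)
    rw [hpe] at h
    rw [h]
    have hc0 := sum_mul_eq_sum_binomial_transform (hp.even_sub_one hp2) c
    rw [hpe] at hc0
    rw [← sub_eq_zero, ← Finset.sum_sub_distrib] at hc0 ⊢
    rw [← neg_eq_zero, ← Finset.sum_neg_distrib]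
    refine Eq.trans (Finset.sum_congr rfl fun j _ ↦ ?_) hc0
    rw [hb]
    ring
  have hrest : PadicPowDvd p (N + 4) (∑ j ∈ Ico (N + 3) p, b j * a j) :=
    PadicPowDvd.sum fun j hj ↦ (hbi j).mul_left
      (padicPowDvd_pow_mul_mhs (m := N + 1) (by omega) hj)
  have h1 := padicPowDvd_pow_mul_mhs_sub hp2 hN.add_one (by omega)
  have hKe : Even (p - 3 - N) := by
    obtain ⟨e, rfl⟩ := hodd
    obtain ⟨d, rfl⟩ := hN
    exact ⟨e - 1 - d, by omega⟩
  have h2 := PadicPowDvd.pow_mul (m := N + 2) (padicPowDvd_mhs_sub (p := p) (m := N + 2)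
    (by omega) (by omega) hKe (by omega))
  have hhalf : PadicPowDvd p 0 (((N : ℚ) + 2) / 2) := by
    obtain ⟨d, rfl⟩ := hN
    convert PadicPowDvd.natCast (p := p) (d + 1) using 1
    push_cast
    ring
  have key := (((hbi (N + 1)).mul_left h1).add
    (((hhalf.mul_left (hbi (N + 1))).add (hbi (N + 2))).mul_left h2)).add hrest
  have hexp : (-((N : ℤ) + 4)) = -((N + 4 : ℕ) : ℤ) := by push_cast; rfl
  rw [hexp]
  change PadicPowDvd p (N + 4) _
  convert key using 1
  rw [hchoose, ← Finset.sum_range_add_sum_Ico _ (show N + 3 ≤ p by omega), Finset.sum_range_succ,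
    Finset.sum_range_succ]
  simp only [ha, mul_assoc]
  push_cast
  have h3 : (N : ℚ) + 2 + 1 = N + 3 := by ring
  rw [h3]
  ring
end

section
/- Let k be an integer, let c_0, c_1, c_2, ... be rational numbers, and for each j ≥ 0 define b_j := (k−1)^j + c_j + (−1)^{j+1} Σ_{i=0}^{j} binom(j, i)·c_i. Let p be an odd prime such that every c_i has p-adic valuation ≥ 0, and let N ≥ p−1 be an integer. Then binom(kp−1, p−1) = Σ_{j=0}^{N} b_j · p^j · H({1}^j; p−1) exactly. -/
open Finset Polynomial

/-- The generating polynomial `∏ (1 + (x / i) X)` of the numbers `x ^ j * H({1}^j; m)`. -/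
theorem prod_one_add_eq_sum_mhs (x : ℚ) {m N : ℕ} (hN : m ≤ N) :
    ∏ i ∈ Finset.Icc 1 m, (1 + (x / (i : ℚ)) • (X : ℚ[X])) =
      ∑ j ∈ Finset.range (N + 1), (x ^ j * mhs j m) • (X : ℚ[X]) ^ j := by
  have h_tail : ∑ j ∈ Finset.range (N + 1), (x ^ j * mhs j m) • (X : ℚ[X]) ^ j =
      ∑ j ∈ Finset.range (m + 1), (x ^ j * mhs j m) • (X : ℚ[X]) ^ j := by
    symm
    apply Finset.sum_subset
    · intro j hj
      simp only [Finset.mem_range] at hj ⊢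
      omega
    · intro j _ hj
      have hjm : m < j := by simpa [Nat.lt_succ_iff] using hj
      have h_empty : Finset.powersetCard j (Finset.Icc 1 m) = ∅ :=
        Finset.powersetCard_eq_empty.mpr (by simpa using hjm)
      simp [mhs, h_empty]
  rw [h_tail, Finset.prod_one_add, Finset.sum_powerset]
  simp only [Nat.card_Icc, Nat.add_sub_cancel]
  refine Finset.sum_congr rfl fun j _ => ?_
  rw [mhs, Finset.mul_sum, Finset.sum_smul]
  refine Finset.sum_congr rfl fun s hs => ?_
  have h_card := (Finset.mem_powersetCard.mp hs).2
  simp only [Finset.prod_smul, Finset.prod_const, div_eq_mul_inv, Finset.prod_mul_distrib,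
    h_card, one_mul]

theorem prod_one_add_comp_neg_one_sub {p : ℕ} (hodd : Odd p) :
    (∏ i ∈ Finset.Icc 1 (p - 1), (1 + ((p : ℚ) / (i : ℚ)) • (X : ℚ[X]))).comp (-1 - X) =
      ∏ i ∈ Finset.Icc 1 (p - 1), (1 + ((p : ℚ) / (i : ℚ)) • (X : ℚ[X])) := by
  have h_even : Even (p - 1) := hodd.tsub_odd odd_one
  have h_factor : ∀ i ∈ Finset.Icc 1 (p - 1), (1 + ((p : ℚ) / (i : ℚ)) • (X : ℚ[X])) =
      C ((i : ℚ)⁻¹) * (C (i : ℚ) + C (p : ℚ) * X) := by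
    intro i hi
    have hi0 : (i : ℚ) ≠ 0 := by
      have := (Finset.mem_Icc.mp hi).1
      positivity
    rw [mul_add, ← C_mul, inv_mul_cancel₀ hi0, ← mul_assoc, ← C_mul, smul_eq_C_mul,
      div_eq_inv_mul, C_1]
  rw [Finset.prod_congr rfl h_factor, Polynomial.prod_comp, Finset.prod_mul_distrib]
  simp only [mul_comp, add_comp, C_comp, X_comp]
  rw [Finset.prod_mul_distrib]
  congr 1
  have h_neg : ∀ i ∈ Finset.Icc 1 (p - 1), (C (i : ℚ) + C (p : ℚ) * (-1 - X) : ℚ[X]) =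
      -1 * (C ((p - i : ℕ) : ℚ) + C (p : ℚ) * X) := by
    intro i hi
    have hip : i ≤ p := by
      have := (Finset.mem_Icc.mp hi).2
      omega
    rw [Nat.cast_sub hip, C_sub]
    ring
  rw [Finset.prod_congr rfl h_neg, Finset.prod_mul_distrib, Finset.prod_const, Nat.card_Icc,
    Nat.add_sub_cancel, h_even.neg_one_pow, one_mul]
  refine Finset.prod_bij' (fun i _ => p - i) (fun i _ => p - i) ?_ ?_ ?_ ?_ ?_
  all_goals intro i hi
  all_goals try simp only [Finset.mem_Icc] at hi ⊢
  all_goals omega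

theorem choose_mul_sub_one_eq_prod (x : ℚ) (p : ℕ) :
    Ring.choose (x * p - 1) (p - 1) =
      ∏ i ∈ Finset.Icc 1 (p - 1), (1 + ((p : ℚ) / (i : ℚ)) * (x - 1)) := by
  have h_fact : ((p - 1).factorial : ℚ) ≠ 0 := by positivity
  apply mul_left_cancel₀ h_fact
  have h_desc := Ring.descPochhammer_eq_factorial_smul_choose (x * p - 1) (p - 1)
  rw [nsmul_eq_mul] at h_desc
  rw [← h_desc, descPochhammer_smeval_eq_ascPochhammer, ascPochhammer_smeval_eq_eval,
    ← descPochhammer_eval_eq_ascPochhammer, descPochhammer_eval_eq_prod_range,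
    ← Finset.prod_Ico_id_eq_factorial, Finset.Ico_add_one_right_eq_Icc, Nat.cast_prod,
    ← Finset.prod_mul_distrib]
  refine Finset.prod_bij' (fun j _ => p - 1 - j) (fun i _ => p - 1 - i) ?_ ?_ ?_ ?_ ?_
  · intro j hj
    simp only [Finset.mem_range, Finset.mem_Icc] at hj ⊢
    omega
  · intro i hi
    simp only [Finset.mem_range, Finset.mem_Icc] at hi ⊢
    omega
  · intro j hj
    simp only [Finset.mem_range] at hj
    omega
  · intro i hi
    simp only [Finset.mem_Icc] at hi
    omega
  · intro j hj
    obtain ⟨d, hd⟩ : ∃ d, p - 1 = j + d + 1 :=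
      Nat.exists_eq_add_of_lt (Finset.mem_range.mp hj)
    have h_index : p - 1 - j = d + 1 := by omega
    have hp : p = j + d + 2 := by omega
    rw [h_index, hp]
    push_cast
    have hd0 : (d : ℚ) + 1 ≠ 0 := by positivity
    field_simp
    ring

theorem constr_basisMonomials_X_pow (c : ℕ → ℚ) (i : ℕ) :
    (Polynomial.basisMonomials ℚ).constr ℚ c (X ^ i) = c i := by
  have h_basis := (Polynomial.basisMonomials ℚ).constr_basis ℚ c i
  rw [coe_basisMonomials] at h_basis
  rwa [X_pow_eq_monomial]

/-- A linear functional applied to the reflection `X ↦ -1 - X` of a monomial. -/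
theorem constr_neg_one_sub_pow (c : ℕ → ℚ) (j : ℕ) :
    (Polynomial.basisMonomials ℚ).constr ℚ c ((-1 - X) ^ j) =
      (-1 : ℚ) ^ j * ∑ i ∈ Finset.range (j + 1), (j.choose i : ℚ) * c i := by
  have h_expand : (-1 - X : ℚ[X]) ^ j =
      ∑ i ∈ Finset.range (j + 1), ((-1 : ℚ) ^ j * (j.choose i : ℚ)) • (X : ℚ[X]) ^ i := by
    rw [show (-1 - X : ℚ[X]) = C (-1) * (X + 1) by simp; ring, mul_pow, add_pow, Finset.mul_sum]
    refine Finset.sum_congr rfl fun i _ => ?_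
    simp [smul_eq_C_mul]
    ring
  rw [h_expand, map_sum, Finset.mul_sum]
  simp only [map_smul, constr_basisMonomials_X_pow, smul_eq_mul, mul_assoc]

theorem stmt13 (k : ℤ) (c : ℕ → ℚ) (b : ℕ → ℚ)
    (hb : ∀ j, b j = ((k : ℚ) - 1) ^ j + c j +
      (-1 : ℚ) ^ (j + 1) * ∑ i ∈ Finset.range (j + 1), (j.choose i : ℚ) * c i)
    (p : ℕ) (hp : p.Prime) (hodd : Odd p)
    (hc : ∀ i, 0 ≤ padicValRat p (c i))
    (N : ℕ) (hN : p - 1 ≤ N) :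
    Ring.choose ((k : ℚ) * p - 1) (p - 1) =
      ∑ j ∈ Finset.range (N + 1), b j * (p : ℚ) ^ j * mhs j (p - 1) := by
  have h_gen := prod_one_add_eq_sum_mhs (p : ℚ) hN
  have h_eval := congrArg (eval ((k : ℚ) - 1)) h_gen
  have h_refl := prod_one_add_comp_neg_one_sub hodd
  rw [h_gen] at h_refl
  have h_func := congrArg ((Polynomial.basisMonomials ℚ).constr ℚ c) h_refl
  simp only [Polynomial.sum_comp, smul_comp, X_pow_comp, map_sum, map_smul, smul_eq_mul,
    constr_basisMonomials_X_pow, constr_neg_one_sub_pow] at h_func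
  simp only [eval_prod, eval_add, eval_one, eval_smul, eval_X, smul_eq_mul, eval_finsetSum,
    eval_pow] at h_eval
  rw [choose_mul_sub_one_eq_prod, h_eval, ← sub_eq_zero, ← Finset.sum_sub_distrib]
  rw [← sub_eq_zero, ← Finset.sum_sub_distrib] at h_func
  rw [← h_func]
  refine Finset.sum_congr rfl fun j _ => ?_
  rw [hb]
  ring
end
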